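/- The number of integers c in the range [-x, x] that can be written in the form c = F_n - T_m for some natural numbers n, m is asymptotically equal to (log x)² / (log((1+√5)/2) · log((1 + (19+3√33)^(1/3) + (19−3√33)^(1/3))/3)) as x → ∞; that is, the ratio of Nat.card {c : ℤ | |c| ≤ x ∧ ∃ n m, (c : ℤ) = F n - T m} to that quantity tends to 1 as the real number x tends to infinity. -/

import Mathlib

open Filter

section ZeroEstimate

open Polynomial

variable {L : Type*} [Field L]

/-- The operator `A ↦ X ^ (-m) * (X * d/dX) (X ^ m * A)` on polynomials. -/
noncomputable def eulerOp (L : Type*) [Field L] (m : ℕ) : Module.End L L[X] :=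
  (m : L) • LinearMap.id + (LinearMap.mulLeft L (X : L[X])).comp derivative

lemma eulerOp_apply (m : ℕ) (A : L[X]) :
    eulerOp L m A = (m : L) • A + X * derivative A := rfl

lemma eulerOp_X_pow_mul (m r : ℕ) (A : L[X]) :
    eulerOp L m (X ^ r * A) = X ^ r * eulerOp L (m + r) A := by
  rcases r with _ | r
  · simp
  · simp only [eulerOp_apply, derivative_mul, derivative_X_pow, smul_eq_C_mul]
    push_cast
    simp only [map_add, map_natCast, map_one]
    ring

lemma eulerOp_pow_X_pow_mul (m r i : ℕ) (A : L[X]) :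
    (eulerOp L m ^ i) (X ^ r * A) = X ^ r * (eulerOp L (m + r) ^ i) A := by
  induction i generalizing A with
  | zero => simp
  | succ i ih => rw [pow_succ, pow_succ, Module.End.mul_apply, Module.End.mul_apply,
      eulerOp_X_pow_mul, ih]

lemma natDegree_eulerOp_pow_le (m i : ℕ) (A : L[X]) :
    ((eulerOp L m ^ i) A).natDegree ≤ A.natDegree := by
  induction i generalizing A with
  | zero => simp
  | succ i ih =>
    rw [pow_succ, Module.End.mul_apply]
    refine (ih _).trans ?_
    rw [eulerOp_apply]
    refine natDegree_add_le_of_degree_le (natDegree_smul_le _ _) ?_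
    rcases Nat.eq_zero_or_pos A.natDegree with h | h
    · rw [natDegree_eq_zero] at h
      obtain ⟨c, rfl⟩ := h
      simp
    · refine natDegree_mul_le.trans ?_
      have := natDegree_derivative_le A
      have := natDegree_X_le (R := L)
      omega

lemma eval_zero_eulerOp_pow (m i : ℕ) (A : L[X]) :
    ((eulerOp L m ^ i) A).eval 0 = (m : L) ^ i * A.eval 0 := by
  induction i generalizing A with
  | zero => simp
  | succ i ih =>
    rw [pow_succ, Module.End.mul_apply, ih, eulerOp_apply]
    simp
    ring

lemma dvd_eulerOp_pow {x : L} {k m : ℕ} (i : ℕ) {A : L[X]} (h : (X - C x) ^ k ∣ A) :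
    (X - C x) ^ (k - i) ∣ (eulerOp L m ^ i) A := by
  induction i generalizing A k with
  | zero => simpa
  | succ i ih =>
    rw [pow_succ, Module.End.mul_apply]
    have : (X - C x) ^ (k - 1) ∣ eulerOp L m A := by
      rw [eulerOp_apply, smul_eq_C_mul]
      refine dvd_add (Dvd.dvd.mul_left ((pow_dvd_pow _ (Nat.sub_le _ _)).trans h) _)
        (Dvd.dvd.mul_left (pow_sub_one_dvd_derivative_of_pow_dvd h) _)
    have := ih this
    rwa [Nat.sub_sub, add_comm 1 i] at this

/-- The Wronskian-type determinant attached to the functions `X ^ (m j) * A j`. -/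
noncomputable def eulerDet {J : ℕ} (m : Fin J → ℕ) (A : Fin J → L[X]) : L[X] :=
  (Matrix.of fun i j : Fin J => (eulerOp L (m j) ^ (i : ℕ)) (A j)).det

lemma natDegree_eulerDet_le {J W : ℕ} (m : Fin J → ℕ) (A : Fin J → L[X])
    (hA : ∀ j, (A j).natDegree ≤ W) : (eulerDet m A).natDegree ≤ J * W := by
  rw [eulerDet, Matrix.det_apply]
  refine natDegree_sum_le_of_forall_le _ _ fun σ _ => ?_
  refine (natDegree_smul_le _ _).trans ((natDegree_prod_le _ _).trans ?_)
  refine (Finset.sum_le_sum (g := fun _ => W) fun j _ => ?_).trans (by simp)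
  exact (natDegree_eulerOp_pow_le _ _ _).trans (hA _)

lemma eulerDet_X_pow_mul {J : ℕ} (m r : Fin J → ℕ) (A : Fin J → L[X]) :
    eulerDet m (fun j => X ^ r j * A j) =
      (∏ j, X ^ r j) * eulerDet (fun j => m j + r j) A := by
  rw [eulerDet, eulerDet, ← Matrix.det_mul_row]
  congr 1
  ext1 i j
  simp [eulerOp_pow_X_pow_mul]

lemma eulerDet_ne_zero [CharZero L] {J : ℕ} (m : Fin J → ℕ) (A : Fin J → L[X])
    (hA : ∀ j, A j ≠ 0)
    (hinj : Function.Injective fun j => m j + (A j).rootMultiplicity 0) :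
    eulerDet m A ≠ 0 := by
  choose B hB hB' using fun j => exists_eq_pow_rootMultiplicity_mul_and_not_dvd (A j) (hA j) 0
  simp only [map_zero, sub_zero] at hB hB'
  set r := fun j => (A j).rootMultiplicity 0
  have hAr : A = fun j => X ^ r j * B j := funext hB
  have h1 : eulerDet m A = (∏ j, X ^ r j) * eulerDet (fun j => m j + r j) B := by
    conv_lhs => rw [hAr]
    exact eulerDet_X_pow_mul _ _ _
  rw [h1]
  refine mul_ne_zero (Finset.prod_ne_zero_iff.2 fun j _ => pow_ne_zero _ X_ne_zero) ?_
  intro h0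
  have h2 : (eulerDet (fun j => m j + r j) B).eval 0 =
      (∏ j, (B j).eval 0) * (Matrix.vandermonde fun j => ((m j + r j : ℕ) : L)).det := by
    rw [eulerDet, ← coe_evalRingHom, RingHom.map_det, ← Matrix.det_transpose (Matrix.vandermonde _),
      ← Matrix.det_mul_row]
    congr 1
    ext1 i j
    simp only [RingHom.mapMatrix_apply, Matrix.map_apply, Matrix.of_apply, coe_evalRingHom,
      eval_zero_eulerOp_pow, Matrix.transpose_apply, Matrix.vandermonde_apply]
    ring
  rw [h0, eval_zero, eq_comm] at h2
  refine mul_ne_zero (Finset.prod_ne_zero_iff.2 fun j _ => ?_) ?_ h2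
  · intro h
    exact hB' j (by rw [X_dvd_iff, coeff_zero_eq_eval_zero, h])
  · rw [Matrix.det_vandermonde_ne_zero_iff]
    exact Nat.cast_injective.comp hinj

lemma dvd_eulerDet {J : ℕ} (m : Fin J → ℕ) (A : Fin J → L[X]) {x : L} (hx : x ≠ 0) {k : ℕ}
    (w : Fin J → L) (j₀ : Fin J) (hw : w j₀ ≠ 0)
    (h : (X - C x) ^ k ∣ ∑ j, w j • (X ^ m j * A j)) :
    (X - C x) ^ (k - J) ∣ eulerDet m A := by
  have h1 : (X - C x) ^ (k - J) ∣ eulerDet 0 (fun j => X ^ m j * A j) := by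
    have h2 := Matrix.det_updateCol_sum
      (Matrix.of fun i j : Fin J => (eulerOp L 0 ^ (i : ℕ)) (X ^ m j * A j)) j₀ (fun j => C (w j))
    have h3 : ∀ i : Fin J, ∃ u, ∑ j, C (w j) * (eulerOp L 0 ^ (i : ℕ)) (X ^ m j * A j) =
        (X - C x) ^ (k - J) * u := by
      intro i
      have h4 : ∑ j, C (w j) * (eulerOp L 0 ^ (i : ℕ)) (X ^ m j * A j) =
          (eulerOp L 0 ^ (i : ℕ)) (∑ j, w j • (X ^ m j * A j)) := by
        rw [map_sum]
        exact Finset.sum_congr rfl fun j _ => by rw [map_smul, smul_eq_C_mul]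
      rw [h4]
      exact (pow_dvd_pow _ (by omega)).trans (dvd_eulerOp_pow (i : ℕ) h)
    choose u hu using h3
    have h5 : (fun k' => ∑ j, C (w j) • (Matrix.of fun i j : Fin J =>
        (eulerOp L 0 ^ (i : ℕ)) (X ^ m j * A j)) k' j) = (X - C x) ^ (k - J) • u := by
      ext1 i
      simpa using hu i
    rw [h5, Matrix.det_updateCol_smul] at h2
    have h6 : (X - C x) ^ (k - J) ∣ C (w j₀) * eulerDet 0 (fun j => X ^ m j * A j) := by
      rw [← smul_eq_mul, eulerDet]
      exact ⟨_, h2.symm⟩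
    exact (isUnit_C.2 hw.isUnit).dvd_mul_left.1 h6
  rw [eulerDet_X_pow_mul] at h1
  simp only [Pi.zero_apply, zero_add] at h1
  refine IsCoprime.dvd_of_dvd_mul_left ?_ h1
  refine IsCoprime.pow_left (IsCoprime.prod_right fun j _ => IsCoprime.pow_right ?_)
  have := isCoprime_X_sub_C_of_isUnit_sub (R := L) (a := x) (b := 0) (by simpa using hx)
  simpa using this

/-- Zero estimate: a lacunary polynomial and a twist of it cannot both vanish to high order. -/
theorem zero_estimate [CharZero L] {J W k₁ k₂ : ℕ} (m : Fin J → ℕ) (A : Fin J → L[X])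
    (hA : ∀ j, A j ≠ 0) (hdeg : ∀ j, (A j).natDegree ≤ W)
    (hinj : Function.Injective fun j => m j + (A j).rootMultiplicity 0)
    {x y : L} (hx : x ≠ 0) (hy : y ≠ 0) (hxy : x ≠ y) (w : Fin J → L) (j₀ : Fin J)
    (hw : w j₀ ≠ 0) (h₁ : (X - C x) ^ k₁ ∣ ∑ j, X ^ m j * A j)
    (h₂ : (X - C y) ^ k₂ ∣ ∑ j, w j • (X ^ m j * A j)) :
    k₁ + k₂ ≤ J * W + 2 * J := by
  have d₁ := dvd_eulerDet m A hx (fun _ => 1) j₀ one_ne_zero (by simpa using h₁)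
  have d₂ := dvd_eulerDet m A hy w j₀ hw h₂
  have hc : IsCoprime ((X - C x) ^ (k₁ - J)) ((X - C y) ^ (k₂ - J)) :=
    (isCoprime_X_sub_C_of_isUnit_sub (sub_ne_zero.2 hxy).isUnit).pow
  have hd := natDegree_le_of_dvd (hc.mul_dvd d₁ d₂) (eulerDet_ne_zero m A hA hinj)
  rw [natDegree_mul (pow_ne_zero _ (X_sub_C_ne_zero _)) (pow_ne_zero _ (X_sub_C_ne_zero _)),
    natDegree_pow, natDegree_pow, natDegree_X_sub_C, natDegree_X_sub_C] at hd
  have := hd.trans (natDegree_eulerDet_le m A hdeg)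
  omega

end ZeroEstimate

section Siegel

open Polynomial

lemma X_sub_C_pow_dvd_of_hasseDeriv {L : Type*} [CommRing L] {p : L[X]} {x : L} {k : ℕ}
    (h : ∀ i < k, (hasseDeriv i p).eval x = 0) : (X - C x) ^ k ∣ p := by
  rw [X_sub_C_pow_dvd_iff, X_pow_dvd_iff]
  intro d hd
  have := taylor_coeff x p d
  rw [taylor_apply] at this
  rw [this, h d hd]

/-- A nonzero lacunary polynomial with blocks of length `W + 1` starting at multiples of `l`,
vanishing to order `k` at `1`, has twisted Hasse derivatives which do not all vanish at `x`. -/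
theorem exists_twisted_hasse_ne_zero {L : Type*} [Field L] [CharZero L] {E W l k k₂ : ℕ}
    (hl : W < l) (a : Fin E × Fin (W + 1) → ℤ) (ha : a ≠ 0)
    (hvan : ∀ i < k, ∑ p, a p * ((p.2 + l * p.1 : ℕ).choose i : ℤ) = 0)
    {x w : L} (hx : x ≠ 0) (hx1 : x ≠ 1) (hw : w ≠ 0) (hk : E * W + 2 * E < k + k₂) :
    ∃ i < k₂, ∑ p, (a p : L) * ((p.2 + l * p.1 : ℕ).choose i : L) *
      (x ^ (p.2 + l * p.1 : ℕ) * w ^ (p.1 : ℕ)) ≠ 0 := by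
  by_contra! hcon
  let A : Fin E → L[X] := fun j => ∑ h : Fin (W + 1), monomial (h : ℕ) (a (j, h) : L)
  have hcoeff : ∀ j (h : Fin (W + 1)), (A j).coeff h = a (j, h) := by
    intro j h
    simp [A, coeff_monomial, Fin.val_inj]
  have hdeg : ∀ j, (A j).natDegree ≤ W := fun j =>
    natDegree_sum_le_of_forall_le _ _ fun h _ => (natDegree_monomial_le _).trans (by omega)
  classical
  let s : Finset (Fin E) := Finset.univ.filter fun j => A j ≠ 0
  have hs : ∀ j, j ∈ s ↔ A j ≠ 0 := fun j => by simp [s]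
  have hne : ∃ j, j ∈ s := by
    obtain ⟨p, hp⟩ := Function.ne_iff.1 ha
    refine ⟨p.1, (hs _).2 fun h0 => hp ?_⟩
    have := hcoeff p.1 p.2
    rw [h0, coeff_zero] at this
    exact_mod_cast this.symm
  obtain ⟨j₀, hj₀⟩ := hne
  let e := s.equivFin
  have hsum : ∀ (v : L), ∑ j, (v ^ ((e.symm j).1 : ℕ)) • (X ^ (l * (e.symm j).1 : ℕ) * A (e.symm j).1)
      = ∑ p : Fin E × Fin (W + 1), monomial (p.2 + l * p.1 : ℕ) ((a p : L) * v ^ (p.1 : ℕ)) := by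
    intro v
    rw [Fintype.sum_equiv e.symm _ (fun j : s => (v ^ ((j : Fin E) : ℕ)) •
      (X ^ (l * (j : Fin E) : ℕ) * A j)) (fun _ => rfl),
      Finset.sum_coe_sort s (fun j : Fin E => (v ^ (j : ℕ)) • (X ^ (l * j : ℕ) * A j)),
      Fintype.sum_prod_type]
    rw [Finset.sum_subset (Finset.subset_univ s)]
    · refine Finset.sum_congr rfl fun j _ => ?_
      simp only [A, Finset.mul_sum, Finset.smul_sum]
      refine Finset.sum_congr rfl fun h _ => ?_
      rw [X_pow_mul_monomial, smul_monomial, smul_eq_mul, mul_comm (_ ^ _), mul_comm l]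
    · intro j _ hj
      rw [hs, not_not] at hj
      simp [hj]
  have key := zero_estimate (L := L) (J := s.card) (W := W) (k₁ := k) (k₂ := k₂)
    (fun j => l * ((e.symm j).1 : ℕ)) (fun j => A (e.symm j).1)
    (fun j => (hs _).1 (e.symm j).2) (fun j => hdeg _) ?_ one_ne_zero hx hx1.symm
    (fun j => (w ^ ((e.symm j).1 : ℕ))) (e ⟨j₀, hj₀⟩) (pow_ne_zero _ hw) ?_ ?_
  · have hc : s.card ≤ E := by simpa using Finset.card_le_univ s
    have := Nat.mul_le_mul_right W hc
    omega
  · intro i j hij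
    simp only at hij
    have h1 : ∀ j, (A j).rootMultiplicity 0 < l := fun j =>
      ((rootMultiplicity_eq_natTrailingDegree'.trans_le (natTrailingDegree_le_natDegree _)).trans
        (hdeg j)).trans_lt hl
    have h2 := congrArg (· / l) hij
    simp only [Nat.mul_add_div (by omega : l > 0), Nat.div_eq_of_lt (h1 _), add_zero] at h2
    exact e.symm.injective (Subtype.ext (Fin.ext h2))
  · have := hsum 1
    simp only [one_pow, one_smul, mul_one] at this
    rw [this]
    refine X_sub_C_pow_dvd_of_hasseDeriv fun i hi => ?_
    simp only [map_sum, hasseDeriv_monomial, eval_finsetSum, eval_monomial, one_pow, mul_one]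
    have := congrArg (Int.cast : ℤ → L) (hvan i hi)
    push_cast at this
    rw [← this]
    exact Finset.sum_congr rfl fun p _ => by ring
  · rw [hsum w]
    refine X_sub_C_pow_dvd_of_hasseDeriv fun i hi => ?_
    simp only [map_sum, hasseDeriv_monomial, eval_finsetSum, eval_monomial]
    have := hcon i hi
    refine (mul_eq_zero_iff_left (pow_ne_zero i hx)).1 ?_
    rw [← this, Finset.mul_sum]
    refine Finset.sum_congr rfl fun p _ => ?_
    rcases le_or_gt i (p.2 + l * p.1 : ℕ) with h | h
    · rw [← pow_sub_mul_pow x h]; ring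
    · rw [Nat.choose_eq_zero_of_lt h]; simp

/-- Siegel's lemma applied to lacunary polynomials vanishing to high order at `1`. -/
theorem exists_lacunary_vanishing {q W l : ℕ} (hq : 0 < q) (hW : 0 < W) (hl : W < l) :
    ∃ a : Fin (4 * q) × Fin (W + 1) → ℤ, a ≠ 0 ∧
      (∀ i < 3 * q * W, ∑ p, a p * ((p.2 + l * p.1 : ℕ).choose i : ℤ) = 0) ∧
      ∀ p, |(a p : ℝ)| ≤ (2 : ℝ) ^ (36 * q * l) := by
  let _ := Matrix.seminormedAddCommGroup (m := Fin (3 * q * W)) (n := Fin (4 * q) × Fin (W + 1))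
    (α := ℤ)
  let M : Matrix (Fin (3 * q * W)) (Fin (4 * q) × Fin (W + 1)) ℤ :=
    Matrix.of fun i p => ((p.2 + l * p.1 : ℕ).choose i : ℤ)
  have hcard : Fintype.card (Fin (4 * q) × Fin (W + 1)) = 4 * q * (W + 1) := by simp
  obtain ⟨a, ha, hMa, hle⟩ := Int.Matrix.exists_ne_zero_int_vec_norm_le M
    (by simp only [hcard, Fintype.card_fin]; nlinarith) (by rw [Fintype.card_fin]; positivity)
  have hs : ∀ p : Fin (4 * q) × Fin (W + 1), (p.2 + l * p.1 : ℕ) ≤ 4 * q * l := by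
    intro p
    have h1 := p.1.2
    have h2 := p.2.2
    have : l * (p.1 : ℕ) + l ≤ l * (4 * q) := by
      rw [← Nat.mul_succ]; exact Nat.mul_le_mul_left _ h1
    nlinarith
  refine ⟨a, ha, ?_, ?_⟩
  · intro i hi
    have := congrFun hMa ⟨i, hi⟩
    simp only [Matrix.mulVec, dotProduct, M, Matrix.of_apply, Pi.zero_apply] at this
    rw [← this]
    exact Finset.sum_congr rfl fun p _ => mul_comm _ _
  · intro p
    have h1 : |(a p : ℝ)| ≤ ‖a‖ := by
      rw [← Int.norm_eq_abs]; exact norm_le_pi_norm a p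
    refine h1.trans (hle.trans ?_)
    have hM : max 1 ‖M‖ ≤ (2 : ℝ) ^ (4 * q * l) := by
      refine max_le (one_le_pow₀ one_le_two) ?_
      rw [Matrix.norm_le_iff (by positivity)]
      intro i p
      simp only [M, Matrix.of_apply, Int.norm_eq_abs]
      push_cast
      rw [abs_of_nonneg (by positivity)]
      have : (p.2 + l * p.1 : ℕ).choose i ≤ 2 ^ (4 * q * l) :=
        (Nat.choose_le_two_pow _ _).trans (Nat.pow_le_pow_right (by norm_num) (hs p))
      exact_mod_cast this
    have hn : ((4 * q * (W + 1) : ℕ) : ℝ) ≤ (2 : ℝ) ^ (8 * q * l) := by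
      have h3 : 4 * q * (W + 1) ≤ 8 * q * l := by nlinarith
      have := (h3.trans (Nat.lt_two_pow_self (n := 8 * q * l)).le)
      exact_mod_cast this
    rw [hcard]
    have hbase : ((4 * q * (W + 1) : ℕ) : ℝ) * max 1 ‖M‖ ≤ (2 : ℝ) ^ (12 * q * l) := by
      calc _ ≤ (2 : ℝ) ^ (8 * q * l) * (2 : ℝ) ^ (4 * q * l) := by gcongr
        _ = _ := by rw [← pow_add]; congr 1; ring
    have hbase1 : 1 ≤ ((4 * q * (W + 1) : ℕ) : ℝ) * max 1 ‖M‖ := by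
      have h1 : 1 ≤ 4 * q * (W + 1) := by nlinarith
      have h2 : (1 : ℝ) ≤ ((4 * q * (W + 1) : ℕ) : ℝ) := by exact_mod_cast h1
      nlinarith [le_max_left 1 ‖M‖]
    calc _ ≤ (((4 * q * (W + 1) : ℕ) : ℝ) * max 1 ‖M‖) ^ (3 : ℝ) := by
          refine Real.rpow_le_rpow_of_exponent_le hbase1 ?_
          rw [Fintype.card_fin]
          have hq' : (0 : ℝ) < q := by exact_mod_cast hq
          have hW' : (0 : ℝ) < W := by exact_mod_cast hW
          push_cast
          rw [div_le_iff₀ (by nlinarith)]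
          nlinarith
      _ ≤ ((2 : ℝ) ^ (12 * q * l)) ^ (3 : ℝ) := by gcongr
      _ = _ := by
        rw [show (3 : ℝ) = ((3 : ℕ) : ℝ) by norm_num, Real.rpow_natCast, ← pow_mul]
        congr 1; ring

end Siegel

section Core

open NumberField

lemma norm_sum_choose_mul_pow_le {ι : Type*} [Fintype ι] {s : ι → ℕ} {S k i : ℕ}
    (hs : ∀ p, s p ≤ S) {a : ι → ℤ} {U : ℝ} (ha : ∀ p, |(a p : ℝ)| ≤ U)
    (hvan : ∀ i < k, ∑ p, a p * ((s p).choose i : ℤ) = 0) {x : ℂ} {ε : ℝ} (hε : ε ≤ 1)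
    (hx : ‖x - 1‖ ≤ ε) :
    ‖∑ p, (a p : ℂ) * ((s p).choose i : ℂ) * x ^ s p‖ ≤
      2 ^ (5 * S) * (Fintype.card ι * U) * ε ^ (k - i) := by
  have hε0 : 0 ≤ ε := (norm_nonneg _).trans hx
  have hU : 0 ≤ Fintype.card ι * U := by
    rcases isEmpty_or_nonempty ι with h | ⟨⟨p⟩⟩
    · simp
    · exact mul_nonneg (Nat.cast_nonneg _) ((abs_nonneg _).trans (ha p))
  have hchoose : ∀ j, ‖((∑ p, a p * ((s p).choose j : ℤ) : ℤ) : ℂ)‖ ≤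
      2 ^ S * (Fintype.card ι * U) := by
    intro j
    push_cast
    refine (norm_sum_le_of_le _ (f := fun p => (a p : ℂ) * ((s p).choose j : ℂ))
      (n := fun _ => U * 2 ^ S) fun p _ => ?_).trans ?_
    · rw [norm_mul]
      have h1 : ‖(a p : ℂ)‖ ≤ U := by rw [Complex.norm_intCast]; exact ha p
      have h2 : ‖((s p).choose j : ℂ)‖ ≤ 2 ^ S := by
        rw [Complex.norm_natCast]
        exact_mod_cast (Nat.choose_le_two_pow _ _).trans (Nat.pow_le_pow_right (by norm_num) (hs p))
      exact mul_le_mul h1 h2 (norm_nonneg _) ((abs_nonneg _).trans (ha p))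
    · simp; apply le_of_eq; ring
  rcases lt_or_ge S i with hi | hi
  · rw [Finset.sum_eq_zero fun p _ => by
      rw [Nat.choose_eq_zero_of_lt ((hs p).trans_lt hi)]; simp]
    simp only [norm_zero]
    positivity
  have hexp : ∑ p, (a p : ℂ) * ((s p).choose i : ℂ) * x ^ s p =
      x ^ i * ∑ l ∈ Finset.range (S + 1), (x - 1) ^ l * ((i + l).choose i : ℂ) *
        ((∑ p, a p * ((s p).choose (i + l) : ℤ) : ℤ) : ℂ) := by
    push_cast
    simp only [Finset.mul_sum]
    rw [Finset.sum_comm]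
    refine Finset.sum_congr rfl fun p _ => ?_
    rcases lt_or_ge (s p) i with h | h
    · rw [Nat.choose_eq_zero_of_lt h]
      rw [Finset.sum_eq_zero fun l _ => by
        rw [Nat.choose_eq_zero_of_lt (show s p < i + l by omega)]; simp]
      simp
    have h1 : x ^ s p = x ^ i * ∑ l ∈ Finset.range (S + 1), (x - 1) ^ l * ((s p - i).choose l : ℂ) := by
      have h3 := add_pow (x - 1) 1 (s p - i)
      simp only [one_pow, mul_one, sub_add_cancel] at h3
      rw [← pow_sub_mul_pow x h, mul_comm, h3]
      congr 1
      refine Finset.sum_subset (fun l hl => ?_) fun l _ hl => ?_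
      · have := hs p
        simp only [Finset.mem_range] at hl ⊢
        omega
      · rw [Finset.mem_range] at hl
        rw [Nat.choose_eq_zero_of_lt (by omega)]; simp
    rw [h1, Finset.mul_sum, Finset.mul_sum]
    refine Finset.sum_congr rfl fun l _ => ?_
    have h2 : (s p).choose (i + l) * (i + l).choose i = (s p).choose i * (s p - i).choose l := by
      simpa using Nat.choose_mul (n := s p) (Nat.le_add_right i l)
    have h2' : ((s p).choose (i + l) : ℂ) * ((i + l).choose i : ℂ) =
      ((s p).choose i : ℂ) * ((s p - i).choose l : ℂ) := by exact_mod_cast h2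
    linear_combination (- x ^ i * (x - 1) ^ l * (a p : ℂ)) * h2'
  rw [hexp, norm_mul, norm_pow]
  have hx2 : ‖x‖ ≤ 2 := by
    calc ‖x‖ = ‖(x - 1) + 1‖ := by ring_nf
      _ ≤ ‖x - 1‖ + ‖(1 : ℂ)‖ := norm_add_le _ _
      _ ≤ 2 := by rw [norm_one]; linarith
  have hsum : ‖∑ l ∈ Finset.range (S + 1), (x - 1) ^ l * ((i + l).choose i : ℂ) *
        ((∑ p, a p * ((s p).choose (i + l) : ℤ) : ℤ) : ℂ)‖ ≤
      ∑ l ∈ Finset.range (S + 1), ε ^ (k - i) * 2 ^ (2 * S) * (2 ^ S * (Fintype.card ι * U)) := by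
    refine norm_sum_le_of_le _ fun l hl => ?_
    rw [Finset.mem_range] at hl
    rcases lt_or_ge (i + l) k with h | h
    · rw [hvan _ h]; simp; positivity
    · rw [norm_mul, norm_mul, norm_pow, Complex.norm_natCast]
      gcongr
      · calc ‖x - 1‖ ^ l ≤ ε ^ l := by gcongr
          _ ≤ ε ^ (k - i) := pow_le_pow_of_le_one hε0 hε (by omega)
      · exact_mod_cast (Nat.choose_le_two_pow _ _).trans
          (Nat.pow_le_pow_right (by norm_num) (by omega))
      · exact hchoose _
  rw [Finset.sum_const, Finset.card_range, nsmul_eq_mul] at hsum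
  have hS : ((S + 1 : ℕ) : ℝ) ≤ 2 ^ S := by exact_mod_cast Nat.lt_two_pow_self (n := S)
  calc _ ≤ 2 ^ S * (2 ^ S * (ε ^ (k - i) * 2 ^ (2 * S) * (2 ^ S * (Fintype.card ι * U)))) := by
        refine mul_le_mul ?_ (hsum.trans (by gcongr)) (norm_nonneg _) (by positivity)
        calc ‖x‖ ^ i ≤ 2 ^ i := by gcongr
          _ ≤ 2 ^ S := pow_le_pow_right₀ one_le_two hi
    _ = _ := by
      rw [show 5 * S = S + S + 2 * S + S by ring, pow_add, pow_add, pow_add]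
      ring

lemma norm_inv_pow_sub_one_le {y : ℂ} {δ : ℝ} (hδ : δ ≤ 1 / 2) (hy : ‖y - 1‖ ≤ δ) (j : ℕ) :
    ‖(y⁻¹) ^ j - 1‖ ≤ 2 ^ (2 * j + 1) * δ := by
  have hδ0 : 0 ≤ δ := (norm_nonneg _).trans hy
  have hy2 : 1 / 2 ≤ ‖y‖ := by
    have := norm_sub_norm_le (1 : ℂ) (1 - y)
    rw [norm_one, norm_sub_rev] at this
    have h2 : (1 : ℂ) - (1 - y) = y := by ring
    rw [h2] at this
    linarith
  have hy0 : y ≠ 0 := by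
    rintro rfl
    norm_num at hy2
  have hv : ‖y⁻¹‖ ≤ 2 := by
    rw [norm_inv, inv_le_comm₀ (by linarith) two_pos]
    linarith
  have hv1 : ‖y⁻¹ - 1‖ ≤ 2 * δ := by
    have : y⁻¹ - 1 = y⁻¹ * (1 - y) := by field_simp
    rw [this, norm_mul, norm_sub_rev]
    gcongr
  induction j with
  | zero => simp; positivity
  | succ j ih =>
    have h1 : (y⁻¹) ^ (j + 1) - 1 = ((y⁻¹) ^ j - 1) * y⁻¹ + (y⁻¹ - 1) := by ring
    rw [h1]
    refine (norm_add_le _ _).trans ?_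
    rw [norm_mul]
    calc _ ≤ 2 ^ (2 * j + 1) * δ * 2 + 2 * δ := by gcongr
      _ ≤ _ := by
        have : (1 : ℝ) ≤ 2 ^ (2 * j + 1) := one_le_pow₀ one_le_two
        rw [show 2 * (j + 1) + 1 = (2 * j + 1) + 2 by ring, pow_add _ (2 * j + 1)]
        generalize (2 : ℝ) ^ (2 * j + 1) = t at this
        nlinarith [mul_le_mul_of_nonneg_right this hδ0]

lemma one_le_norm_mul_house_pow {K : Type*} [Field K] [NumberField K] (σ : K →+* ℂ) {β : K}
    (hβ : IsIntegral ℤ β) (hβ0 : β ≠ 0) :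
    1 ≤ ‖σ β‖ * house β ^ (Module.finrank ℚ K - 1) := by
  refine le_trans ?_ (norm_norm_le_norm_mul_house_pow β σ)
  have h1 : IsIntegral ℤ (Algebra.norm ℚ β) := Algebra.isIntegral_norm ℚ hβ
  obtain ⟨z, hz⟩ := IsIntegrallyClosed.isIntegral_iff.1 h1
  have h2 : Algebra.norm ℚ β ≠ 0 := Algebra.norm_ne_zero_iff.2 hβ0
  rw [← hz] at h2 ⊢
  have hz0 : z ≠ 0 := by rintro rfl; simp at h2
  have : (1 : ℝ) ≤ |(z : ℝ)| := by exact_mod_cast Int.one_le_abs hz0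
  simpa [Int.norm_eq_abs] using this

end Core

section CoreInequality

open NumberField

variable {K : Type*} [Field K] [NumberField K]

lemma house_term_le {A B g g' : K} {M R H : ℝ} (hM : 1 ≤ M) (hA : house A ≤ M) (hB : house B ≤ M)
    (hR : house g ≤ R) (hH : house g' ≤ H) (x y z h j : ℕ) :
    house ((A * B) ^ x * A ^ y * B ^ z * g ^ h * g' ^ j) ≤
      M ^ (2 * x + y + z) * R ^ h * H ^ j := by
  have hM0 : 0 ≤ M := zero_le_one.trans hM
  have hpow : ∀ {u : K} {V : ℝ}, house u ≤ V → ∀ n : ℕ, house (u ^ n) ≤ V ^ n := fun hu n =>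
    (house_pow_le _ n).trans (pow_le_pow_left₀ (house_nonneg _) hu n)
  have hmul : ∀ {u v : K} {U V : ℝ}, house u ≤ U → house v ≤ V → house (u * v) ≤ U * V :=
    fun hu hv => (house_mul_le _ _).trans
      (mul_le_mul hu hv (house_nonneg _) ((house_nonneg _).trans hu))
  refine (hmul (hmul (hmul (hmul (hpow (hmul hA hB) x) (hpow hA y)) (hpow hB z)) (hpow hR h))
    (hpow hH j)).trans_eq ?_
  rw [pow_add, pow_add, pow_mul, sq]

lemma house_sum_mul_choose_le {ι : Type*} [Fintype ι] {s : ι → ℕ} {S i : ℕ} (hs : ∀ p, s p ≤ S)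
    {a : ι → ℤ} {U V : ℝ} (ha : ∀ p, |(a p : ℝ)| ≤ U) {u : ι → K} (hu : ∀ p, house (u p) ≤ V) :
    house (∑ p, (a p : K) * ((s p).choose i : K) * u p) ≤ Fintype.card ι * (U * 2 ^ S * V) := by
  refine (house_sum_le_sum_house _ _).trans ?_
  rw [← nsmul_eq_mul]
  refine Finset.sum_le_card_nsmul _ _ _ fun p _ => ?_
  have hU : 0 ≤ U := (abs_nonneg _).trans (ha p)
  refine (house_mul_le _ _).trans (mul_le_mul ((house_mul_le _ _).trans (mul_le_mul ?_ ?_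
    (house_nonneg _) hU)) (hu p) (house_nonneg _) (by positivity))
  · simpa using ha p
  · have : (((s p).choose i : ℕ) : K) = (((s p).choose i : ℤ) : K) := by simp
    rw [this, house_intCast]
    simp only [Int.cast_natCast, Nat.abs_cast]
    exact_mod_cast (Nat.choose_le_two_pow _ _).trans (Nat.pow_le_pow_right (by norm_num) (hs p))

lemma norm_sum_mul_choose_le {ι : Type*} [Fintype ι] {s : ι → ℕ} {S i : ℕ} (hs : ∀ p, s p ≤ S)
    {a : ι → ℤ} {U V : ℝ} (ha : ∀ p, |(a p : ℝ)| ≤ U) {u : ι → ℂ} (hu : ∀ p, ‖u p‖ ≤ V) :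
    ‖∑ p, (a p : ℂ) * ((s p).choose i : ℂ) * u p‖ ≤ Fintype.card ι * (U * 2 ^ S * V) := by
  refine (norm_sum_le _ _).trans ?_
  rw [← nsmul_eq_mul]
  refine Finset.sum_le_card_nsmul _ _ _ fun p _ => ?_
  have hU : 0 ≤ U := (abs_nonneg _).trans (ha p)
  rw [norm_mul, norm_mul, Complex.norm_intCast, Complex.norm_natCast]
  refine mul_le_mul (mul_le_mul (ha p) ?_ (by positivity) hU) (hu p) (norm_nonneg _) (by positivity)
  exact_mod_cast (Nat.choose_le_two_pow _ _).trans (Nat.pow_le_pow_right (by norm_num) (hs p))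

lemma isIntegral_sum_mul_choose {L : Type*} [Field L] {ι : Type*} [Fintype ι] {s : ι → ℕ} {i : ℕ}
    {a : ι → ℤ} {u : ι → L} (hu : ∀ p, IsIntegral ℤ (u p)) :
    IsIntegral ℤ (∑ p, (a p : L) * ((s p).choose i : L) * u p) := by
  refine IsIntegral.sum _ fun p _ => ((IsIntegral.mul ?_ ?_).mul (hu p))
  · exact isIntegral_algebraMap (R := ℤ) (x := a p)
  · have := isIntegral_algebraMap (R := ℤ) (A := L) (x := (((s p).choose i : ℕ) : ℤ))
    simpa using this

theorem one_le_of_near_one_pair (σ : K →+* ℂ) {A B : K} (hA : IsIntegral ℤ A)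
    (hB : IsIntegral ℤ B) (hA0 : A ≠ 0) (hB0 : B ≠ 0) {q : ℕ} (hq : 2 ≤ q) {G : ℝ} (hG : 1 ≤ G) :
    ∃ C : ℝ, 1 ≤ C ∧ ∀ (g₁ g₂ : K) (l : ℕ) (R ε : ℝ), g₁ ≠ 0 → g₂ ≠ 0 → IsIntegral ℤ g₁ →
      IsIntegral ℤ g₂⁻¹ → 10 * q ≤ l → 1 ≤ R → 0 < ε → ε ≤ 1 / 2 → house g₁ ≤ R →
      house (g₁ ^ l * g₂⁻¹) ≤ G ^ l → A * g₁ / B ≠ 1 → ‖σ (A * g₁ / B) - 1‖ ≤ ε →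
      ‖σ (A * g₂ / B) - 1‖ ≤ ε ^ l → 1 ≤ (C * ε) ^ q * R ^ (Module.finrank ℚ K) := by
  obtain ⟨M, hM1, hMA, hMB⟩ : ∃ M : ℝ, 1 ≤ M ∧ house A ≤ M ∧ house B ≤ M :=
    ⟨max 1 (max (house A) (house B)), by simp, by simp, by simp⟩
  have hM0 : 0 < M := by linarith
  have hG0 : 0 < G := by linarith
  set C₀ : ℝ := 2 ^ (65 * q) * M ^ (16 * q) * G ^ (4 * q) with hC₀
  have hC1 : 1 ≤ C₀ := one_le_mul_of_one_le_of_one_le (one_le_mul_of_one_le_of_one_le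
    (one_le_pow₀ one_le_two) (one_le_pow₀ hM1)) (one_le_pow₀ hG)
  set d := Module.finrank ℚ K with hd
  have hd0 : 0 < d := Module.finrank_pos
  refine ⟨C₀ ^ d, one_le_pow₀ hC1, ?_⟩
  intro g₁ g₂ l R ε hg₁ hg₂ hi₁ hi₂ hl hR hε hε2 hh₁ hh₂ hx1 hn₁ hn₂
  set W := l / q with hW
  have hql : q * W ≤ l := Nat.mul_div_le l q
  have hql' : l < q * W + q := by
    have := Nat.lt_div_mul_add (a := l) (b := q) (by omega)
    rw [mul_comm]; exact this
  have hWpos : 0 < W := Nat.div_pos (by omega) (by omega)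
  have hWl : W < l := Nat.div_lt_self (by omega) (by omega)
  obtain ⟨a, ha0, hvan, hab⟩ := exists_lacunary_vanishing (q := q) (by omega) hWpos hWl
  set x := A * g₁ / B with hx
  set y := A * g₂ / B with hy
  have hx0 : x ≠ 0 := div_ne_zero (mul_ne_zero hA0 hg₁) hB0
  have hy0 : y ≠ 0 := div_ne_zero (mul_ne_zero hA0 hg₂) hB0
  obtain ⟨i, hi, hne⟩ := exists_twisted_hasse_ne_zero (k₂ := q * W + 8 * q + 1) hWl a ha0 hvan hx0
    hx1 (inv_ne_zero hy0) (by nlinarith)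
  set s : Fin (4 * q) × Fin (W + 1) → ℕ := fun p => p.2 + l * p.1 with hs
  have hsS : ∀ p, s p ≤ 4 * q * l := by
    intro p
    have h1 := p.1.2
    have h2 := p.2.2
    have h3 : l * ((p.1 : ℕ) + 1) ≤ l * (4 * q) := Nat.mul_le_mul_left _ h1
    simp only [hs]
    nlinarith
  have hjq : ∀ p : Fin (4 * q) × Fin (W + 1), (p.1 : ℕ) ≤ 4 * q := fun p => p.1.2.le
  have hl1 : 1 ≤ l := by omega
  have hjN : ∀ p, s p + (p.1 : ℕ) ≤ 8 * q * l := by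
    intro p
    have h1 := hjq p
    have h2 := hsS p
    have h3 : 4 * q * 1 ≤ 4 * q * l := Nat.mul_le_mul_left _ hl1
    nlinarith
  have hcard : (Fintype.card (Fin (4 * q) × Fin (W + 1)) : ℝ) ≤ 2 ^ (8 * q * l) := by
    have h1 : Fintype.card (Fin (4 * q) × Fin (W + 1)) ≤ 8 * q * l := by
      simp only [Fintype.card_prod, Fintype.card_fin]
      have : 4 * q * (W + 1) ≤ 4 * q * l := Nat.mul_le_mul_left _ hWl
      nlinarith
    exact_mod_cast h1.trans Nat.lt_two_pow_self.le
  set N := 8 * q * l with hN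
  set u : Fin (4 * q) × Fin (W + 1) → K := fun p => (A * B) ^ (N - (s p + (p.1 : ℕ))) *
    A ^ (2 * s p) * B ^ (2 * (p.1 : ℕ)) * g₁ ^ (p.2 : ℕ) * (g₁ ^ l * g₂⁻¹) ^ (p.1 : ℕ) with hu
  set β : K := ∑ p, (a p : K) * ((s p).choose i : K) * u p with hβ
  have hβeq : β = (A * B) ^ N * ∑ p, (a p : K) * ((s p).choose i : K) *
      (x ^ s p * (y⁻¹) ^ (p.1 : ℕ)) := by
    rw [hβ, Finset.mul_sum]
    refine Finset.sum_congr rfl fun p _ => ?_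
    have h1 : (A * B) ^ N = (A * B) ^ (N - (s p + (p.1 : ℕ))) * (A * B) ^ (s p + (p.1 : ℕ)) := by
      rw [← pow_add, Nat.sub_add_cancel (hjN p)]
    have h2 : u p = (A * B) ^ N * (x ^ s p * (y⁻¹) ^ (p.1 : ℕ)) := by
      rw [h1]
      simp only [hu, hx, hy]
      have h3 : g₁ ^ (p.2 : ℕ) * (g₁ ^ l * g₂⁻¹) ^ (p.1 : ℕ) =
          g₁ ^ s p * g₂⁻¹ ^ (p.1 : ℕ) := by
        simp only [hs]
        rw [mul_pow, ← pow_mul, pow_add]; ring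
      have h4 : (A * B) ^ (s p + (p.1 : ℕ)) * ((A * g₁ / B) ^ s p *
          ((A * g₂ / B)⁻¹) ^ (p.1 : ℕ)) = A ^ (2 * s p) * B ^ (2 * (p.1 : ℕ)) *
          (g₁ ^ s p * g₂⁻¹ ^ (p.1 : ℕ)) := by
        have h5 : y⁻¹ = B * A⁻¹ * g₂⁻¹ := by rw [hy, inv_div]; field_simp
        rw [← hx, ← hy, h5, hx, div_eq_mul_inv, mul_pow, mul_pow, mul_pow, mul_pow, mul_pow, pow_add,
          pow_add, two_mul, two_mul, pow_add, pow_add]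
        have h6 : A ^ (p.1 : ℕ) * A⁻¹ ^ (p.1 : ℕ) = 1 := by
          rw [← mul_pow, mul_inv_cancel₀ hA0, one_pow]
        have h7 : B ^ s p * B⁻¹ ^ s p = 1 := by
          rw [← mul_pow, mul_inv_cancel₀ hB0, one_pow]
        linear_combination (A ^ s p * A ^ s p * B ^ (p.1 : ℕ) * B ^ (p.1 : ℕ) * g₁ ^ s p *
          g₂⁻¹ ^ (p.1 : ℕ)) * (B ^ s p * B⁻¹ ^ s p * h6 + h7)
      rw [mul_assoc ((A * B) ^ (N - (s p + (p.1 : ℕ)))) ((A * B) ^ (s p + (p.1 : ℕ))), h4, ← h3]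
      ring
    rw [h2]; ring
  have hβ0 : β ≠ 0 := by
    rw [hβeq]
    exact mul_ne_zero (pow_ne_zero _ (mul_ne_zero hA0 hB0)) hne
  have hβi : IsIntegral ℤ β := by
    refine isIntegral_sum_mul_choose fun p => ?_
    exact (((((hA.mul hB).pow _).mul (hA.pow _)).mul (hB.pow _)).mul (hi₁.pow _)).mul
      (((hi₁.pow _).mul hi₂).pow _)
  have hβh : house β ≤ C₀ ^ l * R ^ W := by
    refine (house_sum_mul_choose_le hsS hab (V := M ^ (16 * q * l) * R ^ W * G ^ (4 * q * l))
      fun p => ?_).trans ?_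
    · refine (house_term_le hM1 hMA hMB hh₁ hh₂ _ _ _ _ _).trans ?_
      have e1 : 2 * (N - (s p + (p.1 : ℕ))) + 2 * s p + 2 * (p.1 : ℕ) = 16 * q * l := by
        have := hjN p
        have h2 : 16 * q * l = 2 * N := by rw [hN]; ring
        omega
      rw [e1, ← pow_mul]
      have := p.2.2
      have := hjq p
      have h2 : l * (p.1 : ℕ) ≤ 4 * q * l := by nlinarith
      gcongr
      omega
    · calc _ ≤ (2 : ℝ) ^ (8 * q * l) * (2 ^ (36 * q * l) * 2 ^ (4 * q * l) *
            (M ^ (16 * q * l) * R ^ W * G ^ (4 * q * l))) := by gcongr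
        _ = 2 ^ (48 * q * l) * (M ^ (16 * q * l) * R ^ W * G ^ (4 * q * l)) := by
            rw [show 48 * q * l = 8 * q * l + 36 * q * l + 4 * q * l by ring, pow_add, pow_add]
            ring
        _ ≤ 2 ^ (65 * q * l) * (M ^ (16 * q * l) * R ^ W * G ^ (4 * q * l)) := by
            gcongr
            · exact one_le_two
            · norm_num
        _ = _ := by
            rw [hC₀, mul_pow, mul_pow, ← pow_mul, ← pow_mul, ← pow_mul]; ring
  have hσβ : ‖σ β‖ ≤ C₀ ^ l * ε ^ l := by
    have hσx : ‖σ x‖ ≤ 2 := by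
      calc ‖σ x‖ = ‖(σ x - 1) + 1‖ := by ring_nf
        _ ≤ ‖σ x - 1‖ + ‖(1 : ℂ)‖ := norm_add_le _ _
        _ ≤ 2 := by rw [norm_one]; linarith
    have hεl2 : ε ^ l ≤ 1 / 2 :=
      (pow_le_of_le_one hε.le (hε2.trans (by norm_num)) (by omega)).trans hε2
    have hsum₁ : ‖∑ p, (a p : ℂ) * ((s p).choose i : ℂ) * σ x ^ s p‖ ≤ 2 ^ (64 * q * l) * ε ^ l := by
      refine (norm_sum_choose_mul_pow_le hsS hab hvan (by linarith) hn₁).trans ?_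
      calc _ ≤ (2 : ℝ) ^ (5 * (4 * q * l)) * (2 ^ (8 * q * l) * 2 ^ (36 * q * l)) * ε ^ l := by
            have hki : l ≤ 3 * q * W - i := by
              have : 3 * q * W = 3 * (q * W) := by ring
              omega
            have := pow_le_pow_of_le_one hε.le (by linarith) hki
            gcongr
        _ = _ := by
            rw [show 64 * q * l = 5 * (4 * q * l) + (8 * q * l + 36 * q * l) by ring, pow_add,
              pow_add]
    have hsum₂ : ‖∑ p, (a p : ℂ) * ((s p).choose i : ℂ) *
        (σ x ^ s p * ((σ y)⁻¹ ^ (p.1 : ℕ) - 1))‖ ≤ 2 ^ (64 * q * l) * ε ^ l := by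
      refine (norm_sum_mul_choose_le hsS hab (V := 2 ^ (4 * q * l) * (2 ^ (8 * q * l) * ε ^ l))
        fun p => ?_).trans ?_
      · rw [norm_mul, norm_pow]
        refine mul_le_mul ((pow_le_pow_left₀ (norm_nonneg _) hσx _).trans
          (pow_le_pow_right₀ one_le_two (hsS p)))
          ((norm_inv_pow_sub_one_le hεl2 hn₂ _).trans ?_) (norm_nonneg _) (by positivity)
        have h1 : 2 * (p.1 : ℕ) + 1 ≤ 8 * q * l := by
          have h2 := p.1.2
          have h3 : 8 * q * 1 ≤ 8 * q * l := Nat.mul_le_mul_left _ hl1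
          omega
        gcongr
        exact one_le_two
      · calc _ ≤ (2 : ℝ) ^ (8 * q * l) * (2 ^ (36 * q * l) * 2 ^ (4 * q * l) *
              (2 ^ (4 * q * l) * (2 ^ (8 * q * l) * ε ^ l))) := by gcongr
          _ = 2 ^ (60 * q * l) * ε ^ l := by
              rw [show 60 * q * l = 8 * q * l + (36 * q * l + 4 * q * l + (4 * q * l + 8 * q * l))
                by ring, pow_add, pow_add, pow_add, pow_add]
              ring
          _ ≤ _ := by
              gcongr
              · exact one_le_two
              · norm_num
    have hsplit : σ β = (σ A * σ B) ^ N * (∑ p, (a p : ℂ) * ((s p).choose i : ℂ) * σ x ^ s p +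
        ∑ p, (a p : ℂ) * ((s p).choose i : ℂ) * (σ x ^ s p * ((σ y)⁻¹ ^ (p.1 : ℕ) - 1))) := by
      rw [hβeq, ← Finset.sum_add_distrib]
      simp only [map_mul, map_pow, map_sum, map_intCast, map_natCast, map_inv₀]
      congr 1
      exact Finset.sum_congr rfl fun p _ => by ring
    have hAN : ‖(σ A * σ B) ^ N‖ ≤ M ^ (16 * q * l) := by
      rw [norm_pow, norm_mul]
      calc (‖σ A‖ * ‖σ B‖) ^ N ≤ (M * M) ^ N := by
            have h1 := (norm_embedding_le_house A σ).trans hMA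
            have h2 := (norm_embedding_le_house B σ).trans hMB
            gcongr
        _ = _ := by
            rw [← sq, ← pow_mul, hN]; ring_nf
    rw [hsplit, norm_mul]
    calc _ ≤ M ^ (16 * q * l) * (2 ^ (64 * q * l) * ε ^ l + 2 ^ (64 * q * l) * ε ^ l) :=
          mul_le_mul hAN ((norm_add_le _ _).trans (add_le_add hsum₁ hsum₂)) (norm_nonneg _)
            (by positivity)
      _ = 2 ^ (64 * q * l + 1) * M ^ (16 * q * l) * 1 * ε ^ l := by rw [pow_succ]; ring
      _ ≤ 2 ^ (65 * q * l) * M ^ (16 * q * l) * G ^ (4 * q * l) * ε ^ l := by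
          have h1 : 64 * q * l + 1 ≤ 65 * q * l := by
            have : 1 * 1 ≤ q * l := Nat.mul_le_mul (by omega) hl1
            nlinarith
          have h2 : 1 ≤ G ^ (4 * q * l) := one_le_pow₀ hG
          gcongr
          exact one_le_two
      _ = _ := by rw [hC₀, mul_pow, mul_pow, ← pow_mul, ← pow_mul, ← pow_mul]
  have h1 := one_le_norm_mul_house_pow σ hβi hβ0
  have hεl : 0 < ε ^ l := by positivity
  have h2 : 1 ≤ (C₀ ^ d * ε) ^ l * R ^ (W * d) := by
    calc 1 ≤ ‖σ β‖ * house β ^ (d - 1) := h1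
      _ ≤ (C₀ ^ l * ε ^ l) * (C₀ ^ l * R ^ W) ^ (d - 1) := by
        refine mul_le_mul hσβ (pow_le_pow_left₀ (house_nonneg _) hβh _)
          (pow_nonneg (house_nonneg _) _) (by positivity)
      _ = (C₀ ^ (1 + (d - 1)) * ε) ^ l * R ^ (W * (d - 1)) := by
        rw [pow_add, mul_pow, mul_pow, mul_pow, ← pow_mul, ← pow_mul, ← pow_mul, ← pow_mul]
        ring
      _ ≤ (C₀ ^ d * ε) ^ l * R ^ (W * d) := by
        rw [Nat.add_sub_cancel' hd0]
        gcongr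
        omega
  have h3 : 1 ≤ ((C₀ ^ d * ε) ^ q * R ^ d) ^ l := by
    calc 1 ≤ ((C₀ ^ d * ε) ^ l * R ^ (W * d)) ^ q := one_le_pow₀ h2
      _ = (C₀ ^ d * ε) ^ (q * l) * R ^ (q * W * d) := by
        rw [mul_pow, ← pow_mul, ← pow_mul]; ring_nf
      _ ≤ (C₀ ^ d * ε) ^ (q * l) * R ^ (l * d) := by
        gcongr
      _ = _ := by
        rw [mul_pow _ (R ^ d), ← pow_mul, ← pow_mul, mul_comm l d]
  exact (one_le_pow_iff_of_nonneg (by positivity) (by omega)).1 h3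

end CoreInequality

section Finiteness

open NumberField

variable {K : Type*} [Field K] [NumberField K]

lemma house_zpow_le {f : K} {M : ℝ} (h1 : house f ≤ M) (h2 : house f⁻¹ ≤ M) (z : ℤ) :
    house (f ^ z) ≤ M ^ z.natAbs := by
  rcases Int.natAbs_eq z with h | h
  · conv_lhs => rw [h, zpow_natCast]
    exact (house_pow_le _ _).trans (pow_le_pow_left₀ (house_nonneg _) h1 _)
  · conv_lhs => rw [h, zpow_neg, zpow_natCast, ← inv_pow]
    exact (house_pow_le _ _).trans (pow_le_pow_left₀ (house_nonneg _) h2 _)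

theorem finite_setOf_near_one (σ : K →+* ℂ) {A B f t : K} (hA : IsIntegral ℤ A)
    (hB : IsIntegral ℤ B) (hA0 : A ≠ 0) (hB0 : B ≠ 0) (hf : IsIntegral ℤ f)
    (hf' : IsIntegral ℤ f⁻¹) (hf0 : f ≠ 0) (ht : IsIntegral ℤ t) (ht' : IsIntegral ℤ t⁻¹)
    (ht0 : t ≠ 0) {c : ℝ} (hc : 1 < c) (r D : ℝ) :
    {n : ℕ | ∃ m : ℕ, |(m : ℝ) - r * n| ≤ D ∧ A * (f ^ n * t⁻¹ ^ m) / B ≠ 1 ∧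
      ‖σ (A * (f ^ n * t⁻¹ ^ m) / B) - 1‖ ≤ (c⁻¹) ^ n}.Finite := by
  by_contra hinf
  rw [← Set.Infinite] at hinf
  obtain ⟨M, hM1, hMf, hMf', hMt, hMt'⟩ : ∃ M : ℝ, 1 ≤ M ∧ house f ≤ M ∧ house f⁻¹ ≤ M ∧
      house t ≤ M ∧ house t⁻¹ ≤ M :=
    ⟨max 1 (max (max (house f) (house f⁻¹)) (max (house t) (house t⁻¹))), by simp, by simp,
      by simp, by simp, by simp⟩
  have hM0 : 0 < M := by linarith
  obtain ⟨κ, hκ⟩ := exists_nat_ge (|r| + 2 * |D|)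
  obtain ⟨d, hd⟩ : ∃ d, Module.finrank ℚ K = d := ⟨_, rfl⟩
  obtain ⟨q₀, hq₀⟩ := pow_unbounded_of_one_lt (M ^ ((1 + κ) * d)) hc
  obtain ⟨q, hq2, hq⟩ : ∃ q : ℕ, 2 ≤ q ∧ M ^ ((1 + κ) * d) < c ^ q :=
    ⟨q₀ + 2, by omega, hq₀.trans_le (pow_le_pow_right₀ hc.le (by omega))⟩
  obtain ⟨C, hC1, hC⟩ := one_le_of_near_one_pair σ hA hB hA0 hB0 hq2 (G := M ^ (1 + κ))
    (one_le_pow₀ hM1)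
  rw [hd] at hC
  have hc0 : 0 < c := by linarith
  have hci : c⁻¹ < 1 := inv_lt_one_of_one_lt₀ hc
  have hlim1 : Tendsto (fun n : ℕ => (c⁻¹) ^ n) atTop (nhds 0) :=
    tendsto_pow_atTop_nhds_zero_of_lt_one (by positivity) hci
  have hlim2 : Tendsto (fun n : ℕ => C ^ q * ((c⁻¹) ^ q * M ^ ((1 + κ) * d)) ^ n) atTop (nhds 0) := by
    rw [← mul_zero (C ^ q)]
    refine (tendsto_pow_atTop_nhds_zero_of_lt_one (by positivity) ?_).const_mul _
    rw [inv_pow, inv_mul_lt_iff₀ (by positivity), mul_one]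
    exact hq
  have hev := ((hlim1.eventually (ge_mem_nhds (show (0 : ℝ) < 1 / 2 by norm_num))).and
    ((hlim2.eventually (gt_mem_nhds one_pos)).and (eventually_ge_atTop 1)))
  obtain ⟨n₁, ⟨m₁, hm₁, hne₁, hn₁⟩, hε2, hlt, hn1⟩ :=
    ((Nat.frequently_atTop_iff_infinite.2 hinf).and_eventually hev).exists
  obtain ⟨n₂, ⟨m₂, hm₂, hne₂, hn₂⟩, hlarge⟩ :=
    ((Nat.frequently_atTop_iff_infinite.2 hinf).and_eventually
      (eventually_ge_atTop ((n₁ + 10 * q) * n₁))).exists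
  set l := n₂ / n₁ with hl
  have hl1 : n₁ + 10 * q ≤ l := (Nat.le_div_iff_mul_le hn1).2 hlarge
  have hln : l * n₁ ≤ n₂ := Nat.div_mul_le_self _ _
  have hln' : n₂ < l * n₁ + n₁ := Nat.lt_div_mul_add hn1
  have hti : house (t⁻¹)⁻¹ ≤ M := by rwa [inv_inv]
  have hr0 := abs_nonneg r
  have hD0 := abs_nonneg D
  have hDD := le_abs_self D
  have hr : (1 : ℝ) ≤ n₁ := by exact_mod_cast hn1
  have key := hC (f ^ n₁ * t⁻¹ ^ m₁) (f ^ n₂ * t⁻¹ ^ m₂) l (M ^ ((1 + κ) * n₁)) ((c⁻¹) ^ n₁)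
    (by positivity) (by positivity) ((hf.pow _).mul (ht'.pow _))
    (by
      rw [mul_inv, ← inv_pow, ← inv_pow, inv_inv]
      exact (hf'.pow _).mul (ht.pow _))
    (by omega) (one_le_pow₀ hM1) (by positivity) hε2 ?_ ?_ hne₁ hn₁ ?_
  · refine absurd key (not_le.2 (lt_of_eq_of_lt ?_ hlt))
    rw [mul_pow, mul_pow, ← pow_mul, ← pow_mul, ← pow_mul, ← pow_mul]
    ring_nf
  · have hmκ : m₁ ≤ κ * n₁ := by
      have h1 := (abs_le.1 hm₁).2
      have h2 : r * n₁ ≤ |r| * n₁ := by gcongr; exact le_abs_self r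
      have h3 : (m₁ : ℝ) ≤ κ * n₁ := by nlinarith
      exact_mod_cast h3
    refine (house_mul_le _ _).trans ?_
    calc _ ≤ M ^ n₁ * M ^ m₁ := mul_le_mul
          ((house_pow_le _ _).trans (pow_le_pow_left₀ (house_nonneg _) hMf _))
          ((house_pow_le _ _).trans (pow_le_pow_left₀ (house_nonneg _) hMt' _))
          (house_nonneg _) (by positivity)
      _ = M ^ (n₁ + m₁) := (pow_add _ _ _).symm
      _ ≤ _ := pow_le_pow_right₀ hM1 (by nlinarith)
  · have e : (f ^ n₁ * t⁻¹ ^ m₁) ^ l * (f ^ n₂ * t⁻¹ ^ m₂)⁻¹ =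
        f ^ ((l * n₁ : ℤ) - n₂) * t⁻¹ ^ ((l * m₁ : ℤ) - m₂) := by
      rw [zpow_sub₀ hf0, zpow_sub₀ (inv_ne_zero ht0), mul_pow, ← pow_mul, ← pow_mul, mul_comm n₁,
        mul_comm m₁]
      have e1 : f ^ ((l : ℤ) * n₁) = f ^ (l * n₁) := by exact_mod_cast zpow_natCast f (l * n₁)
      have e2 : t⁻¹ ^ ((l : ℤ) * m₁) = t⁻¹ ^ (l * m₁) := by
        exact_mod_cast zpow_natCast t⁻¹ (l * m₁)
      rw [e1, e2, zpow_natCast, zpow_natCast, mul_inv]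
      ring
    have b1 : ((l * n₁ : ℤ) - n₂).natAbs ≤ l := by
      have h1 : ((l * n₁ : ℤ)) ≤ n₂ := by exact_mod_cast hln
      have h2 : (n₂ : ℤ) < l * n₁ + n₁ := by exact_mod_cast hln'
      omega
    have b2 : ((l * m₁ : ℤ) - m₂).natAbs ≤ κ * l := by
      have h1 : ((((l * m₁ : ℤ) - m₂).natAbs : ℕ) : ℝ) = |(l : ℝ) * m₁ - m₂| := by
        rw [Nat.cast_natAbs]; push_cast; rfl
      have h2 : |(l : ℝ) * m₁ - m₂| ≤ κ * l := by
        have e2 : (l : ℝ) * m₁ - m₂ = l * (m₁ - r * n₁) + (r * (l * n₁ - n₂) - (m₂ - r * n₂)) := by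
          ring
        have h3 : |(l : ℝ) * n₁ - n₂| ≤ l := by
          have h4 : ((l : ℝ) * n₁) ≤ n₂ := by exact_mod_cast hln
          have h5 : (n₂ : ℝ) ≤ l * n₁ + n₁ := by exact_mod_cast hln'.le
          have h6 : (n₁ : ℝ) ≤ l := by exact_mod_cast (show n₁ ≤ l by omega)
          rw [abs_le]; constructor <;> linarith
        have hlr : (1 : ℝ) ≤ l := by exact_mod_cast (show 1 ≤ l by omega)
        rw [e2]
        calc _ ≤ |(l : ℝ) * (m₁ - r * n₁)| + (|r * (l * n₁ - n₂)| + |(m₂ : ℝ) - r * n₂|) :=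
              (abs_add_le _ _).trans (by gcongr; exact abs_sub _ _)
          _ ≤ l * D + (|r| * l + D) := by
              rw [abs_mul, abs_mul, abs_of_nonneg (by positivity : (0 : ℝ) ≤ l)]
              gcongr
          _ ≤ (|r| + 2 * |D|) * l := by nlinarith
          _ ≤ _ := by gcongr
      have h3 : ((((l * m₁ : ℤ) - m₂).natAbs : ℕ) : ℝ) ≤ ((κ * l : ℕ) : ℝ) := by
        rw [h1]; push_cast; exact h2
      exact_mod_cast h3
    rw [e, ← pow_mul]
    refine (house_mul_le _ _).trans ?_
    calc _ ≤ M ^ ((l * n₁ : ℤ) - n₂).natAbs * M ^ ((l * m₁ : ℤ) - m₂).natAbs :=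
          mul_le_mul (house_zpow_le hMf hMf' _) (house_zpow_le hMt' hti _) (house_nonneg _)
            (by positivity)
      _ = M ^ (((l * n₁ : ℤ) - n₂).natAbs + ((l * m₁ : ℤ) - m₂).natAbs) := (pow_add _ _ _).symm
      _ ≤ _ := pow_le_pow_right₀ hM1 (by nlinarith)
  · refine hn₂.trans ?_
    rw [← pow_mul]
    exact pow_le_pow_of_le_one (by positivity) hci.le (by rwa [mul_comm])

end Finiteness

section GoldenTribonacci

open NumberField Polynomial

lemma exists_ringHom_golden_eq {K : Type*} [Field K] [NumberField K] {f : K} (hf : f ^ 2 = f + 1)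
    {z : ℂ} (hz : z ^ 2 = z + 1) : ∃ σ : K →+* ℂ, σ f = z := by
  set P : ℤ[X] := X ^ 2 - X - 1 with hP
  have hPm : P.Monic := by rw [hP]; monicity!
  have hPd : P.natDegree = 2 := by rw [hP]; compute_degree!
  have hf_int : IsIntegral ℚ f := Algebra.IsIntegral.isIntegral f
  have hmin : minpoly ℚ f = P.map (algebraMap ℤ ℚ) := by
    refine (eq_of_monic_of_dvd_of_natDegree_le (minpoly.monic hf_int) (hPm.map _)
      (minpoly.dvd ℚ f ?_) ?_).symm
    · simp [hP, hf]
    · rw [natDegree_map_eq_of_injective (RingHom.injective_int _), hPd,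
        minpoly.two_le_natDegree_iff hf_int]
      rintro ⟨r, rfl⟩
      have hr : r ^ 2 = r + 1 := by
        have : ((r ^ 2 : ℚ) : K) = ((r + 1 : ℚ) : K) := by push_cast; exact hf
        exact_mod_cast this
      have hri : IsIntegral ℤ r := ⟨P, hPm, by simp [hP, hr]⟩
      obtain ⟨k, rfl⟩ := IsIntegrallyClosed.isIntegral_iff.1 hri
      have hk : k ^ 2 = k + 1 := by
        rw [algebraMap_int_eq, eq_intCast] at hr
        exact_mod_cast hr
      have h1 : k * (k - 1) = 1 := by linear_combination hk
      rcases Int.eq_one_or_neg_one_of_mul_eq_one h1 with h | h <;> subst h <;> norm_num at hk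
  have hz' : z ∈ (minpoly ℚ f).rootSet ℂ := by
    rw [mem_rootSet]
    refine ⟨minpoly.ne_zero hf_int, ?_⟩
    rw [hmin]
    simp [hP, hz]
  rw [← NumberField.Embeddings.range_eval_eq_rootSet_minpoly K ℂ f] at hz'
  exact hz'

lemma norm_mul_ne_one_of_tribonacci {τ : ℝ} (hτ1 : 1 < τ) (hτ : τ ^ 3 = τ ^ 2 + τ + 1) {z : ℂ}
    (hz : z ^ 3 = z ^ 2 + z + 1) : ‖z‖ * τ ≠ 1 := by
  intro h
  have hz0 : z ≠ 0 := by rintro rfl; norm_num at hz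
  have hw : z⁻¹ ^ 4 = 2 * z⁻¹ - 1 := by
    field_simp
    linear_combination (z - 1) * hz
  have hnw : ‖z⁻¹‖ = τ := by
    rw [norm_inv]
    exact inv_eq_of_mul_eq_one_right h
  have h1 : τ ^ 4 ≤ 2 * τ + 1 := by
    rw [← hnw, ← norm_pow, hw]
    refine (norm_sub_le _ _).trans ?_
    simp
  nlinarith [mul_pos (sub_pos.2 hτ1) (sub_pos.2 hτ1)]

lemma golden_pow_ne_tribonacci_pow {K : Type*} [Field K] [NumberField K] {f t : K}
    (hf : f ^ 2 = f + 1) (ht : t ^ 3 = t ^ 2 + t + 1) (σ : K →+* ℂ) {φ τ : ℝ} (hφ1 : 1 < φ)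
    (hτ1 : 1 < τ) (hσf : σ f = φ) (hσt : σ t = τ) {d : ℕ} (hd : d ≠ 0) (e : ℕ) :
    f ^ d ≠ t ^ e := by
  intro h
  have hφ : φ ^ 2 = φ + 1 := by
    have := congrArg σ hf
    simp only [map_pow, map_add, map_one, hσf] at this
    exact_mod_cast this
  have hτ : τ ^ 3 = τ ^ 2 + τ + 1 := by
    have := congrArg σ ht
    simp only [map_pow, map_add, map_one, hσt] at this
    exact_mod_cast this
  obtain ⟨σ', hσ'⟩ := exists_ringHom_golden_eq hf (z := ((1 - φ : ℝ) : ℂ))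
    (by norm_cast; linear_combination hφ)
  have h1 : φ ^ d = τ ^ e := by
    have := congrArg σ h
    simp only [map_pow, hσf, hσt] at this
    exact_mod_cast this
  have he : e ≠ 0 := by
    rintro rfl
    rw [pow_zero] at h1
    exact (one_lt_pow₀ hφ1 hd).ne' h1
  have h2 : ‖σ' t‖ ^ e = ‖σ' f‖ ^ d := by rw [← norm_pow, ← norm_pow, ← map_pow, ← map_pow, h]
  have h3 : ‖σ' f‖ * φ = 1 := by
    rw [hσ', Complex.norm_real, Real.norm_eq_abs, abs_of_neg (by linarith)]
    linear_combination hφ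
  refine norm_mul_ne_one_of_tribonacci hτ1 hτ (z := σ' t) ?_ ?_
  · have := congrArg σ' ht
    simpa only [map_pow, map_add, map_one] using this
  · rw [← pow_eq_one_iff_of_nonneg (by positivity) he, mul_pow, h2, ← h1, ← mul_pow, h3, one_pow]

theorem finite_setOf_golden_tribonacci_near_one {φ τ : ℝ} (hφ1 : 1 < φ) (hφ : φ ^ 2 = φ + 1)
    (hτ1 : 1 < τ) (hτ : τ ^ 3 = τ ^ 2 + τ + 1) {c : ℝ} (hc : 1 < c) (r D : ℝ) :
    {n : ℕ | ∃ m : ℕ, |(m : ℝ) - r * n| ≤ D ∧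
      |(3 * τ ^ 2 - 2 * τ - 1) * (φ ^ n * τ⁻¹ ^ m) / (2 * φ - 1) - 1| ≤ (c⁻¹) ^ n}.Finite := by
  have hφi : IsIntegral ℤ φ := ⟨X ^ 2 - X - 1, by monicity!, by simp [hφ]⟩
  have hτi : IsIntegral ℤ τ := ⟨X ^ 3 - X ^ 2 - X - 1, by monicity!, by simp [hτ]; ring⟩
  let K := IntermediateField.adjoin ℚ ({φ, τ} : Set ℝ)
  have : FiniteDimensional ℚ K := IntermediateField.finiteDimensional_adjoin_pair
    (hφi.tower_top) (hτi.tower_top)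
  have : NumberField K := ⟨⟩
  let f : K := ⟨φ, IntermediateField.subset_adjoin _ _ (by simp)⟩
  let t : K := ⟨τ, IntermediateField.subset_adjoin _ _ (by simp)⟩
  let ι : K →+* ℝ := algebraMap K ℝ
  have hι : Function.Injective ι := ι.injective
  have hιf : ι f = φ := rfl
  have hιt : ι t = τ := rfl
  let σ : K →+* ℂ := Complex.ofRealHom.comp ι
  have hf : f ^ 2 = f + 1 := hι (by simpa [hιf] using hφ)
  have ht : t ^ 3 = t ^ 2 + t + 1 := hι (by simpa [hιt] using hτ)
  have hf0 : f ≠ 0 := by rintro h; simp [h] at hf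
  have ht0 : t ≠ 0 := by rintro h; simp [h] at ht
  have hfi : IsIntegral ℤ f := ⟨X ^ 2 - X - 1, by monicity!, by simp [hf]⟩
  have hti : IsIntegral ℤ t := ⟨X ^ 3 - X ^ 2 - X - 1, by monicity!, by simp [ht]; ring⟩
  have h1i : IsIntegral ℤ (1 : K) := isIntegral_one
  have hni : ∀ n : ℕ, IsIntegral ℤ (n : K) := fun n => by
    simpa using isIntegral_algebraMap (R := ℤ) (A := K) (x := (n : ℤ))
  have hfi' : IsIntegral ℤ f⁻¹ := by
    rw [show f⁻¹ = f - 1 by field_simp; linear_combination -hf]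
    exact hfi.sub h1i
  have hti' : IsIntegral ℤ t⁻¹ := by
    rw [show t⁻¹ = t ^ 2 - t - 1 by field_simp; linear_combination -ht]
    exact ((hti.pow 2).sub hti).sub h1i
  have hA : IsIntegral ℤ (3 * t ^ 2 - 2 * t - 1) :=
    ((((hni 3).mul (hti.pow 2)).sub ((hni 2).mul hti)).sub h1i)
  have hB : IsIntegral ℤ (2 * f - 1) := ((hni 2).mul hfi).sub h1i
  have hA0 : 3 * t ^ 2 - 2 * t - 1 ≠ 0 := by
    intro h
    have h1 := congrArg ι h
    simp only [map_sub, map_mul, map_pow, hιt, map_one, map_ofNat, map_zero] at h1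
    nlinarith
  have hB0 : 2 * f - 1 ≠ 0 := by
    intro h
    have h1 := congrArg ι h
    simp only [map_sub, map_mul, hιf, map_one, map_ofNat, map_zero] at h1
    linarith
  have hfin := finite_setOf_near_one σ hA hB hA0 hB0 hfi hfi' hf0 hti hti' ht0 hc r D
  have hsub : {n : ℕ | ∃ m : ℕ, (3 * t ^ 2 - 2 * t - 1) * (f ^ n * t⁻¹ ^ m) / (2 * f - 1) = 1}.Subsingleton := by
    have hmain : ∀ n₁ n₂ m₁ m₂ : ℕ, n₁ < n₂ →
        (3 * t ^ 2 - 2 * t - 1) * (f ^ n₁ * t⁻¹ ^ m₁) / (2 * f - 1) = 1 →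
        (3 * t ^ 2 - 2 * t - 1) * (f ^ n₂ * t⁻¹ ^ m₂) / (2 * f - 1) = 1 → False := by
      intro n₁ n₂ m₁ m₂ hn h1 h2
      have h3 : f ^ n₁ * t⁻¹ ^ m₁ = f ^ n₂ * t⁻¹ ^ m₂ := by
        rw [div_eq_one_iff_eq hB0] at h1 h2
        exact mul_left_cancel₀ hA0 (h1.trans h2.symm)
      have h4 : f ^ n₁ * t ^ m₂ = f ^ n₂ * t ^ m₁ := by
        rw [inv_pow, inv_pow] at h3
        field_simp at h3
        linear_combination h3
      have h5 : t ^ m₂ = f ^ (n₂ - n₁) * t ^ m₁ := by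
        rw [← Nat.add_sub_cancel' hn.le, pow_add, mul_assoc] at h4
        exact mul_left_cancel₀ (pow_ne_zero _ hf0) h4
      have h6 : m₁ ≤ m₂ := by
        by_contra! hlt
        have h7 := congrArg ι h5
        simp only [map_pow, map_mul, hιf, hιt] at h7
        have h8 : τ ^ m₂ < τ ^ m₁ := pow_lt_pow_right₀ hτ1 hlt
        have h9 : 1 ≤ φ ^ (n₂ - n₁) := one_le_pow₀ hφ1.le
        nlinarith [pow_pos (zero_lt_one.trans hτ1) m₁]
      rw [← Nat.sub_add_cancel h6, pow_add] at h5
      exact golden_pow_ne_tribonacci_pow hf ht σ hφ1 hτ1 rfl rfl (by omega) _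
        (mul_right_cancel₀ (pow_ne_zero _ ht0) h5).symm
    rintro n₁ ⟨m₁, h1⟩ n₂ ⟨m₂, h2⟩
    rcases lt_trichotomy n₁ n₂ with h | h | h
    · exact (hmain _ _ _ _ h h1 h2).elim
    · exact h
    · exact (hmain _ _ _ _ h h2 h1).elim
  refine (hfin.union hsub.finite).subset ?_
  rintro n ⟨m, hm, hn⟩
  by_cases hX : (3 * t ^ 2 - 2 * t - 1) * (f ^ n * t⁻¹ ^ m) / (2 * f - 1) = 1
  · exact Or.inr ⟨m, hX⟩
  · refine Or.inl ⟨m, hm, hX, ?_⟩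
    have h1 : σ ((3 * t ^ 2 - 2 * t - 1) * (f ^ n * t⁻¹ ^ m) / (2 * f - 1)) - 1 =
        (((3 * τ ^ 2 - 2 * τ - 1) * (φ ^ n * τ⁻¹ ^ m) / (2 * φ - 1) - 1 : ℝ) : ℂ) := by
      have hσf : σ f = φ := rfl
      have hσt : σ t = τ := rfl
      have hσ2 : σ 2 = 2 := map_ofNat σ 2
      have hσ3 : σ 3 = 3 := map_ofNat σ 3
      simp [hσf, hσt, hσ2, hσ3]
    rw [h1, Complex.norm_real, Real.norm_eq_abs]
    exact hn

end GoldenTribonacci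

section Sequences

lemma golden_pow_le {F : ℕ → ℤ} (hF0 : F 0 = 0) (hF1 : F 1 = 1)
    (hFrec : ∀ n : ℕ, F (n + 2) = F n + F (n + 1)) {φ : ℝ} (hφ1 : 1 < φ) (hφ : φ ^ 2 = φ + 1) :
    ∀ n : ℕ, φ ^ (n + 1) ≤ φ ^ 2 * F (n + 1)
  | 0 => by rw [hF1]; push_cast; nlinarith
  | 1 => by simp [hFrec, hF0, hF1]
  | n + 2 => by
    have h1 := golden_pow_le hF0 hF1 hFrec hφ1 hφ n
    have h2 := golden_pow_le hF0 hF1 hFrec hφ1 hφ (n + 1)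
    rw [hFrec (n + 1)]
    push_cast
    have h3 : φ ^ (n + 2 + 1) = φ ^ (n + 1) + φ ^ (n + 1 + 1) := by
      linear_combination φ ^ (n + 1) * hφ
    rw [h3]; linarith

lemma mul_le_golden_pow {F : ℕ → ℤ} (hF0 : F 0 = 0) (hF1 : F 1 = 1)
    (hFrec : ∀ n : ℕ, F (n + 2) = F n + F (n + 1)) {φ : ℝ} (hφ : φ ^ 2 = φ + 1) :
    ∀ n : ℕ, φ * F n ≤ φ ^ n
  | 0 => by simp [hF0]
  | 1 => by simp [hF1]
  | n + 2 => by
    have h1 := mul_le_golden_pow hF0 hF1 hFrec hφ n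
    have h2 := mul_le_golden_pow hF0 hF1 hFrec hφ (n + 1)
    rw [hFrec n]
    push_cast
    have h3 : φ ^ (n + 2) = φ ^ n + φ ^ (n + 1) := by linear_combination φ ^ n * hφ
    rw [h3]; linarith

lemma tribonacci_pow_le {T : ℕ → ℤ} (hT0 : T 0 = 0) (hT1 : T 1 = 1) (hT2 : T 2 = 1)
    (hTrec : ∀ m : ℕ, T (m + 3) = T m + T (m + 1) + T (m + 2)) {τ : ℝ} (hτ1 : 1 < τ)
    (hτ : τ ^ 3 = τ ^ 2 + τ + 1) : ∀ m : ℕ, τ ^ (m + 1) ≤ τ ^ 2 * T (m + 1)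
  | 0 => by rw [hT1]; push_cast; nlinarith
  | 1 => by rw [hT2]; simp
  | 2 => by
    have h : τ + 1 ≤ τ ^ 2 := by nlinarith
    have h3 : T (2 + 1) = 2 := by rw [show 2 + 1 = 0 + 3 from rfl, hTrec, hT0, hT1, hT2]; norm_num
    rw [h3]; push_cast; nlinarith
  | m + 3 => by
    have h1 := tribonacci_pow_le hT0 hT1 hT2 hTrec hτ1 hτ m
    have h2 := tribonacci_pow_le hT0 hT1 hT2 hTrec hτ1 hτ (m + 1)
    have h3 := tribonacci_pow_le hT0 hT1 hT2 hTrec hτ1 hτ (m + 2)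
    rw [show m + 3 + 1 = (m + 1) + 3 by ring, hTrec (m + 1)]
    push_cast
    have h4 : τ ^ (m + 1 + 3) = τ ^ (m + 1) + τ ^ (m + 1 + 1) + τ ^ (m + 2 + 1) := by
      linear_combination τ ^ (m + 1) * hτ
    rw [h4]; linarith

lemma mul_le_tribonacci_pow {T : ℕ → ℤ} (hT0 : T 0 = 0) (hT1 : T 1 = 1) (hT2 : T 2 = 1)
    (hTrec : ∀ m : ℕ, T (m + 3) = T m + T (m + 1) + T (m + 2)) {τ : ℝ} (hτ1 : 1 < τ)
    (hτ : τ ^ 3 = τ ^ 2 + τ + 1) : ∀ m : ℕ, τ * T m ≤ τ ^ m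
  | 0 => by simp [hT0]
  | 1 => by simp [hT1]
  | 2 => by rw [hT2]; push_cast; nlinarith
  | m + 3 => by
    have h1 := mul_le_tribonacci_pow hT0 hT1 hT2 hTrec hτ1 hτ m
    have h2 := mul_le_tribonacci_pow hT0 hT1 hT2 hTrec hτ1 hτ (m + 1)
    have h3 := mul_le_tribonacci_pow hT0 hT1 hT2 hTrec hτ1 hτ (m + 2)
    rw [hTrec m]
    push_cast
    have h4 : τ ^ (m + 3) = τ ^ m + τ ^ (m + 1) + τ ^ (m + 2) := by linear_combination τ ^ m * hτ
    rw [h4]; linarith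

lemma abs_sub_golden_pow_le {F : ℕ → ℤ} (hF0 : F 0 = 0) (hF1 : F 1 = 1)
    (hFrec : ∀ n : ℕ, F (n + 2) = F n + F (n + 1)) {φ : ℝ} (hφ1 : 1 < φ) (hφ : φ ^ 2 = φ + 1)
    (n : ℕ) : |(2 * φ - 1) * F n - φ ^ n| ≤ 1 := by
  have h : ∀ n, (2 * φ - 1) * F n = φ ^ n - (1 - φ) ^ n ∧
      (2 * φ - 1) * F (n + 1) = φ ^ (n + 1) - (1 - φ) ^ (n + 1) := by
    intro n
    induction n with
    | zero => simp [hF0, hF1]; ring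
    | succ n ih =>
      refine ⟨ih.2, ?_⟩
      rw [hFrec n]
      push_cast
      have h1 : φ ^ (n + 1 + 1) = φ ^ n + φ ^ (n + 1) := by linear_combination φ ^ n * hφ
      have h2 : (1 - φ) ^ (n + 1 + 1) = (1 - φ) ^ n + (1 - φ) ^ (n + 1) := by
        linear_combination (1 - φ) ^ n * hφ
      rw [h1, h2, mul_add, ih.1, ih.2]; ring
  rw [(h n).1, sub_sub_cancel_left, abs_neg, abs_pow]
  refine pow_le_one₀ (abs_nonneg _) ?_
  rw [abs_le]
  constructor <;> nlinarith

lemma exists_abs_sub_tribonacci_pow_le {T : ℕ → ℤ} (hT0 : T 0 = 0) (hT1 : T 1 = 1) (hT2 : T 2 = 1)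
    (hTrec : ∀ m : ℕ, T (m + 3) = T m + T (m + 1) + T (m + 2)) {τ : ℝ} (hτ1 : 1 < τ)
    (hτ : τ ^ 3 = τ ^ 2 + τ + 1) :
    ∃ E : ℝ, ∀ m : ℕ, |(3 * τ ^ 2 - 2 * τ - 1) * T m - τ ^ (m + 1)| ≤ E := by
  set e : ℕ → ℝ := fun m => (3 * τ ^ 2 - 2 * τ - 1) * T m - τ ^ (m + 1) with he
  have hτ18 : 9 / 5 < τ := by
    by_contra! h
    nlinarith
  have hτ2 : τ < 2 := by
    by_contra! h
    nlinarith
  have he3 : ∀ m, e (m + 3) = e m + e (m + 1) + e (m + 2) := by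
    intro m
    simp only [he, hTrec m]
    push_cast
    linear_combination -τ ^ (m + 1) * hτ
  have hrec : ∀ m, τ * e (m + 2) = τ * (1 - τ) * e (m + 1) - e m := by
    intro m
    induction m with
    | zero =>
      simp only [he, hT0, hT1, hT2, zero_add]
      push_cast
      linear_combination τ * hτ
    | succ m ih =>
      rw [show m + 1 + 2 = m + 3 from rfl, he3 m, show m + 1 + 1 = m + 2 from rfl]
      linear_combination τ * ih - e (m + 1) * hτ
  set Q : ℕ → ℝ := fun m => τ * e (m + 1) ^ 2 - τ * (1 - τ) * e (m + 1) * e m + e m ^ 2 with hQ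
  have hQrec : ∀ m, τ * Q (m + 1) = Q m := by
    intro m
    simp only [hQ]
    rw [show m + 1 + 1 = m + 2 from rfl]
    linear_combination (τ * e (m + 2) - e m) * hrec m
  have hsq : ∀ m, e m ^ 2 ≤ 2 * Q m := by
    intro m
    have h1 : τ * (1 - τ) ^ 2 ≤ 2 := by nlinarith
    have h2 : Q m = τ * (e (m + 1) - (1 - τ) / 2 * e m) ^ 2 +
        (1 - τ * (1 - τ) ^ 2 / 4) * e m ^ 2 := by simp only [hQ]; ring
    have h3 : 0 ≤ τ * (e (m + 1) - (1 - τ) / 2 * e m) ^ 2 := by positivity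
    have h4 := mul_le_mul_of_nonneg_right h1 (sq_nonneg (e m))
    rw [h2]
    linarith
  have hQ0 : ∀ m, Q m ≤ Q 0 := by
    intro m
    induction m with
    | zero => exact le_rfl
    | succ m ih =>
      refine le_trans ?_ ih
      have h1 := hQrec m
      have h2 : 0 ≤ Q (m + 1) := by linarith [hsq (m + 1), sq_nonneg (e (m + 1))]
      nlinarith
  have hbd : ∀ m, e m ^ 2 ≤ 2 * Q 0 := fun m => (hsq m).trans (by linarith [hQ0 m])
  refine ⟨Real.sqrt (2 * Q 0), fun m => Real.abs_le_sqrt (hbd m)⟩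

lemma abs_log_mul_sub_le {F T : ℕ → ℤ} (hF0 : F 0 = 0) (hF1 : F 1 = 1)
    (hFrec : ∀ n : ℕ, F (n + 2) = F n + F (n + 1))
    (hT0 : T 0 = 0) (hT1 : T 1 = 1) (hT2 : T 2 = 1)
    (hTrec : ∀ m : ℕ, T (m + 3) = T m + T (m + 1) + T (m + 2)) {φ τ : ℝ} (hφ1 : 1 < φ)
    (hφ : φ ^ 2 = φ + 1) (hτ1 : 1 < τ) (hτ : τ ^ 3 = τ ^ 2 + τ + 1) {n m : ℕ} (hn : n ≠ 0)
    (hm : m ≠ 0) (h1 : F n ≤ 3 * T m) (h2 : T m ≤ 3 * F n) :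
    |m * Real.log τ - n * Real.log φ| ≤ Real.log 12 := by
  have hτ2 : τ < 2 := by
    by_contra! h
    nlinarith
  have hφ2 : φ < 2 := by
    by_contra! h
    nlinarith
  obtain ⟨n, rfl⟩ := Nat.exists_eq_succ_of_ne_zero hn
  obtain ⟨m, rfl⟩ := Nat.exists_eq_succ_of_ne_zero hm
  have a1 := golden_pow_le hF0 hF1 hFrec hφ1 hφ n
  have a2 := mul_le_golden_pow hF0 hF1 hFrec hφ (n + 1)
  have a3 := tribonacci_pow_le hT0 hT1 hT2 hTrec hτ1 hτ m
  have a4 := mul_le_tribonacci_pow hT0 hT1 hT2 hTrec hτ1 hτ (m + 1)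
  have h1' : (F (n + 1) : ℝ) ≤ 3 * T (m + 1) := by exact_mod_cast h1
  have h2' : (T (m + 1) : ℝ) ≤ 3 * F (n + 1) := by exact_mod_cast h2
  have pφ : 0 < φ ^ (n + 1) := by positivity
  have pτ : 0 < τ ^ (m + 1) := by positivity
  have pF : 0 < (F (n + 1) : ℝ) := by
    by_contra! h; nlinarith [sq_nonneg φ]
  have pT : 0 < (T (m + 1) : ℝ) := by
    by_contra! h; nlinarith [sq_nonneg τ]
  have d1 : φ ^ 2 * F (n + 1) ≤ 4 * F (n + 1) := by nlinarith
  have d2 : τ ^ 2 * T (m + 1) ≤ 4 * T (m + 1) := by nlinarith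
  have d3 : (F (n + 1) : ℝ) ≤ φ * F (n + 1) := by nlinarith
  have d4 : (T (m + 1) : ℝ) ≤ τ * T (m + 1) := by nlinarith
  have b1 : φ ^ (n + 1) ≤ 12 * τ ^ (m + 1) := by linarith
  have b2 : τ ^ (m + 1) ≤ 12 * φ ^ (n + 1) := by linarith
  have c1 := Real.log_le_log pφ b1
  have c2 := Real.log_le_log pτ b2
  rw [Real.log_mul (by norm_num) pτ.ne', Real.log_pow, Real.log_pow] at c1
  rw [Real.log_mul (by norm_num) pφ.ne', Real.log_pow, Real.log_pow] at c2
  rw [abs_le]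
  constructor <;> linarith

end Sequences

section Close

theorem finite_setOf_fibonacci_close_tribonacci {F T : ℕ → ℤ} (hF0 : F 0 = 0) (hF1 : F 1 = 1)
    (hFrec : ∀ n : ℕ, F (n + 2) = F n + F (n + 1))
    (hT0 : T 0 = 0) (hT1 : T 1 = 1) (hT2 : T 2 = 1)
    (hTrec : ∀ m : ℕ, T (m + 3) = T m + T (m + 1) + T (m + 2)) {φ τ : ℝ} (hφ1 : 1 < φ)
    (hφ : φ ^ 2 = φ + 1) (hτ1 : 1 < τ) (hτ : τ ^ 3 = τ ^ 2 + τ + 1) :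
    {n : ℕ | ∃ m : ℕ, |(F n : ℝ) - T m| ≤ (5 / 4) ^ n}.Finite := by
  obtain ⟨E, hE⟩ := exists_abs_sub_tribonacci_pow_le hT0 hT1 hT2 hTrec hτ1 hτ
  set A := 3 * τ ^ 2 - 2 * τ - 1 with hA
  set B := 2 * φ - 1 with hB
  have hA0 : 0 < A := by rw [hA]; nlinarith
  have hB1 : 1 < B := by rw [hB]; linarith
  have hE0 : 0 ≤ E := (abs_nonneg _).trans (hE 0)
  have hφ16 : 8 / 5 ≤ φ := by
    by_contra! h
    nlinarith
  have hφ2 : φ < 2 := by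
    by_contra! h
    nlinarith
  have hlogτ : 0 < Real.log τ := Real.log_pos hτ1
  have hfin := finite_setOf_golden_tribonacci_near_one hφ1 hφ hτ1 hτ (c := 11 / 10) (by norm_num)
    (Real.log φ / Real.log τ) (1 + Real.log 12 / Real.log τ)
  set M := A * B + A + B * E with hM
  have hM0 : 0 ≤ M := by positivity
  have hlim1 : Tendsto (fun n : ℕ => 12 * (25 / 32 : ℝ) ^ n) atTop (nhds 0) := by
    rw [← mul_zero (12 : ℝ)]
    exact (tendsto_pow_atTop_nhds_zero_of_lt_one (by norm_num) (by norm_num)).const_mul _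
  have hlim2 : Tendsto (fun n : ℕ => 6 * M * (25 / 32 * (11 / 10) : ℝ) ^ n) atTop (nhds 0) := by
    rw [← mul_zero (6 * M)]
    exact (tendsto_pow_atTop_nhds_zero_of_lt_one (by norm_num) (by norm_num)).const_mul _
  obtain ⟨n₀, hn₀⟩ := eventually_atTop.1 ((hlim1.eventually (ge_mem_nhds one_pos)).and
    ((hlim2.eventually (ge_mem_nhds one_pos)).and (eventually_ge_atTop 1)))
  refine (hfin.union (Set.finite_Iio n₀)).subset ?_
  rintro n ⟨m, hm⟩
  rcases lt_or_ge n n₀ with hn | hn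
  · exact Or.inr hn
  left
  obtain ⟨h1, h2, hn1⟩ := hn₀ n hn
  have hpφ : 0 < φ ^ n := by positivity
  have hFn : φ ^ n ≤ 4 * F n := by
    obtain ⟨k, rfl⟩ := Nat.exists_eq_succ_of_ne_zero (show n ≠ 0 by omega)
    have h3 := golden_pow_le hF0 hF1 hFrec hφ1 hφ k
    have h4 : 0 < (F (k + 1) : ℝ) := by
      have h5 := pow_pos (zero_lt_one.trans hφ1) (k + 1)
      exact pos_of_mul_pos_right (h5.trans_le h3) (sq_nonneg φ)
    refine h3.trans ?_
    have : φ ^ 2 ≤ 4 := by nlinarith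
    exact mul_le_mul_of_nonneg_right this h4.le
  have h54 : (5 / 4 : ℝ) ^ n ≤ (25 / 32) ^ n * φ ^ n := by
    rw [← mul_pow]
    gcongr
    linarith
  have h54' : (5 / 4 : ℝ) ^ n ≤ F n / 3 := by nlinarith
  have hm' := abs_le.1 hm
  have hFT : (F n : ℝ) ≤ 3 * T m := by linarith
  have hTF : (T m : ℝ) ≤ 3 * F n := by linarith
  have hm0 : m ≠ 0 := by
    rintro rfl
    rw [hT0] at hm'
    push_cast at hm'
    linarith
  have hstrip := abs_log_mul_sub_le hF0 hF1 hFrec hT0 hT1 hT2 hTrec hφ1 hφ hτ1 hτ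
    (show n ≠ 0 by omega) hm0 (by exact_mod_cast hFT) (by exact_mod_cast hTF)
  refine ⟨m + 1, ?_, ?_⟩
  · have e1 : (((m + 1 : ℕ) : ℝ) - Real.log φ / Real.log τ * n) =
        1 + (m * Real.log τ - n * Real.log φ) / Real.log τ := by
      push_cast
      field_simp
      ring
    rw [e1]
    refine (abs_add_le _ _).trans ?_
    rw [abs_one, abs_div, abs_of_pos hlogτ]
    gcongr
  · have hTm := mul_le_tribonacci_pow hT0 hT1 hT2 hTrec hτ1 hτ m
    have hTpos : 0 < (T m : ℝ) := by linarith
    have hpτ : φ ^ n ≤ 6 * τ ^ (m + 1) := by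
      have e1 : (T m : ℝ) ≤ τ * T m := by nlinarith
      have e2 : τ ^ m ≤ τ ^ (m + 1) := pow_le_pow_right₀ hτ1.le (by omega)
      linarith
    have hpτ0 : 0 < τ ^ (m + 1) := by positivity
    have e1 : A * (φ ^ n * τ⁻¹ ^ (m + 1)) / B - 1 =
        (A * B * (F n - T m) - A * (B * F n - φ ^ n) + B * (A * T m - τ ^ (m + 1))) /
          (B * τ ^ (m + 1)) := by
      rw [inv_pow]
      have : B ≠ 0 := by positivity
      field_simp
      ring
    have h5 : (1 : ℝ) ≤ (5 / 4) ^ n := one_le_pow₀ (by norm_num)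
    have e2 : |A * B * (F n - T m) - A * (B * F n - φ ^ n) + B * (A * T m - τ ^ (m + 1))| ≤
        M * (5 / 4) ^ n := by
      have hB0 : 0 < B := by linarith
      have k2 := abs_sub_golden_pow_le hF0 hF1 hFrec hφ1 hφ n
      calc _ ≤ |A * B * (F n - T m)| + |A * (B * F n - φ ^ n)| + |B * (A * T m - τ ^ (m + 1))| :=
            (abs_add_le _ _).trans (by gcongr; exact abs_sub _ _)
        _ = A * B * |(F n : ℝ) - T m| + A * |B * F n - φ ^ n| + B * |A * T m - τ ^ (m + 1)| := by
            simp only [abs_mul, abs_of_pos hA0, abs_of_pos hB0]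
        _ ≤ A * B * (5 / 4) ^ n + A * 1 + B * E := by
            gcongr
            exact hE m
        _ ≤ A * B * (5 / 4) ^ n + A * (5 / 4) ^ n + B * E * (5 / 4) ^ n := by
            have k3 := le_mul_of_one_le_right hA0.le h5
            have k4 := le_mul_of_one_le_right (mul_nonneg hB0.le hE0) h5
            linarith
        _ = _ := by rw [hM]; ring
    rw [e1, abs_div, abs_of_pos (by positivity : 0 < B * τ ^ (m + 1)), div_le_iff₀ (by positivity)]
    refine e2.trans ?_
    have e3 : τ ^ (m + 1) ≤ B * τ ^ (m + 1) := le_mul_of_one_le_left hpτ0.le hB1.le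
    have e4 : (11 / 10 : ℝ)⁻¹ ^ n * (11 / 10) ^ n = 1 := by
      rw [← mul_pow]; norm_num
    have e5 : 6 * M * (25 / 32) ^ n ≤ (11 / 10 : ℝ)⁻¹ ^ n := by
      rw [mul_pow] at h2
      have e6 : 0 < (11 / 10 : ℝ)⁻¹ ^ n := by positivity
      calc 6 * M * (25 / 32) ^ n = (6 * M * ((25 / 32) ^ n * (11 / 10) ^ n)) *
            (11 / 10 : ℝ)⁻¹ ^ n := by linear_combination (-6 * M * (25 / 32) ^ n) * e4
        _ ≤ 1 * (11 / 10 : ℝ)⁻¹ ^ n := by gcongr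
        _ = _ := one_mul _
    calc M * (5 / 4) ^ n ≤ M * ((25 / 32) ^ n * φ ^ n) := by gcongr
      _ ≤ M * ((25 / 32) ^ n * (6 * τ ^ (m + 1))) := by gcongr
      _ = 6 * M * (25 / 32) ^ n * τ ^ (m + 1) := by ring
      _ ≤ (11 / 10 : ℝ)⁻¹ ^ n * (B * τ ^ (m + 1)) := by gcongr

end Close

section Counting

lemma exists_floor_add_sub_eq {a b c : ℝ} (hb : 0 < b) (ha : 0 ≤ a) {k : ℕ} (hk : c / b + 1 ≤ k)
    {n m : ℕ} (h : |m * b - n * a| ≤ c) :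
    ∃ j ∈ Finset.range (2 * k + 1), ⌊n * a / b⌋₊ + j - k = m := by
  obtain ⟨h1, h2⟩ := abs_le.1 h
  have h3 : (⌊n * a / b⌋₊ : ℝ) ≤ n * a / b := Nat.floor_le (by positivity)
  have h4 : n * a / b < ⌊n * a / b⌋₊ + 1 := Nat.lt_floor_add_one _
  have h5 : (m : ℝ) ≤ n * a / b + c / b := by
    rw [← add_div, le_div_iff₀ hb]; linarith
  have h6 : n * a / b - c / b ≤ m := by
    rw [← sub_div, div_le_iff₀ hb]; linarith
  have h7 : ⌊n * a / b⌋₊ ≤ m + k := by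
    have : (⌊n * a / b⌋₊ : ℝ) ≤ m + k := by linarith
    exact_mod_cast this
  have h8 : m ≤ ⌊n * a / b⌋₊ + k := by
    have : (m : ℝ) ≤ ⌊n * a / b⌋₊ + k := by linarith
    exact_mod_cast this
  exact ⟨m + k - ⌊n * a / b⌋₊, by rw [Finset.mem_range]; omega, by omega⟩

lemma fibonacci_pos {F : ℕ → ℤ} (hF0 : F 0 = 0) (hF1 : F 1 = 1)
    (hFrec : ∀ n : ℕ, F (n + 2) = F n + F (n + 1)) : ∀ n : ℕ, 0 < F (n + 1)
  | 0 => by simp [hF1]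
  | 1 => by simp [hFrec, hF0, hF1]
  | n + 2 => by
    have h1 := fibonacci_pos hF0 hF1 hFrec n
    have h2 := fibonacci_pos hF0 hF1 hFrec (n + 1)
    rw [hFrec (n + 1)]
    exact add_pos h1 h2

lemma tribonacci_pos {T : ℕ → ℤ} (hT0 : T 0 = 0) (hT1 : T 1 = 1) (hT2 : T 2 = 1)
    (hTrec : ∀ m : ℕ, T (m + 3) = T m + T (m + 1) + T (m + 2)) : ∀ m : ℕ, 0 < T (m + 1)
  | 0 => by simp [hT1]
  | 1 => by simp [hT2]
  | 2 => by simp [hTrec, hT0, hT1, hT2]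
  | m + 3 => by
    have h1 := tribonacci_pos hT0 hT1 hT2 hTrec m
    have h2 := tribonacci_pos hT0 hT1 hT2 hTrec (m + 1)
    have h3 := tribonacci_pos hT0 hT1 hT2 hTrec (m + 2)
    rw [show m + 3 + 1 = (m + 1) + 3 by ring, hTrec (m + 1)]
    exact add_pos (add_pos h1 h2) h3

lemma three_mul_tribonacci_le {T : ℕ → ℤ} (hT0 : T 0 = 0) (hT1 : T 1 = 1) (hT2 : T 2 = 1)
    (hTrec : ∀ m : ℕ, T (m + 3) = T m + T (m + 1) + T (m + 2)) :
    ∀ m : ℕ, 3 * T (m + 2) ≤ 2 * T (m + 3)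
  | 0 => by simp [hTrec, hT0, hT1, hT2]
  | 1 => by simp [hTrec, hT0, hT1, hT2]
  | 2 => by simp [hTrec, hT0, hT1, hT2]
  | m + 3 => by
    have h1 := three_mul_tribonacci_le hT0 hT1 hT2 hTrec m
    have h2 := three_mul_tribonacci_le hT0 hT1 hT2 hTrec (m + 1)
    have h3 := three_mul_tribonacci_le hT0 hT1 hT2 hTrec (m + 2)
    have h4 := hTrec (m + 2)
    have h5 := hTrec (m + 3)
    simp only [add_assoc, Nat.reduceAdd] at *
    linarith

lemma le_three_mul_of_sub_eq_sub {F T : ℕ → ℤ} (hF0 : F 0 = 0) (hF1 : F 1 = 1)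
    (hFrec : ∀ n : ℕ, F (n + 2) = F n + F (n + 1))
    (hT0 : T 0 = 0) (hT1 : T 1 = 1) (hT2 : T 2 = 1)
    (hTrec : ∀ m : ℕ, T (m + 3) = T m + T (m + 1) + T (m + 2)) {n m n' m' : ℕ}
    (hn' : 2 ≤ n') (hm : 2 ≤ m) (hm' : 2 ≤ m') (hn : n' < n) (h : F n - T m = F n' - T m') :
    F n ≤ 3 * T m ∧ T m ≤ 3 * F n := by
  have hFp := fibonacci_pos hF0 hF1 hFrec
  have hTp := tribonacci_pos hT0 hT1 hT2 hTrec
  have hFm : Monotone F := monotone_nat_of_le_succ fun n => by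
    cases n with
    | zero => simp [hF0, hF1]
    | succ n =>
      rw [hFrec]
      cases n with
      | zero => simp [hF0]
      | succ n => linarith [hFp n]
  have hTm : Monotone T := monotone_nat_of_le_succ fun m => by
    match m with
    | 0 => simp [hT0, hT1]
    | 1 => simp [hT1, hT2]
    | 2 => simp [hTrec, hT0, hT1, hT2]
    | m + 3 =>
      rw [show m + 3 + 1 = (m + 1) + 3 by ring, hTrec (m + 1)]
      have := hTp m
      have := hTp (m + 1)
      simp only [add_assoc, Nat.reduceAdd] at *
      linarith
  obtain ⟨k, rfl⟩ : ∃ k, n = k + 3 := ⟨n - 3, by omega⟩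
  have f1 : F n' ≤ F (k + 2) := hFm (by omega)
  have f2 : F (k + 2) = F k + F (k + 1) := hFrec k
  have f3 : F (k + 3) = F (k + 1) + F (k + 2) := hFrec (k + 1)
  have f4 : F k ≤ F (k + 1) := hFm (by omega)
  have f5 := hFp k
  have f6 : 0 ≤ F n' := by rw [← hF0]; exact hFm (by omega)
  have t6 : 0 ≤ T m' := by rw [← hT0]; exact hTm (by omega)
  have hmm : m' < m := by
    by_contra! hle
    have := hTm hle
    linarith
  obtain ⟨j, rfl⟩ : ∃ j, m = j + 3 := ⟨m - 3, by omega⟩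
  have t1 : T m' ≤ T (j + 2) := hTm (by omega)
  have t2 := three_mul_tribonacci_le hT0 hT1 hT2 hTrec j
  constructor <;> linarith

lemma eq_of_tribonacci_eq {T : ℕ → ℤ} (hT0 : T 0 = 0) (hT1 : T 1 = 1) (hT2 : T 2 = 1)
    (hTrec : ∀ m : ℕ, T (m + 3) = T m + T (m + 1) + T (m + 2)) {m m' : ℕ} (hm : 2 ≤ m)
    (hm' : 2 ≤ m') (h : T m = T m') : m = m' := by
  have hTp := tribonacci_pos hT0 hT1 hT2 hTrec
  have hs : StrictMono fun j => T (j + 2) := strictMono_nat_of_lt_succ fun j => by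
    rw [show j + 1 + 2 = j + 3 from rfl, hTrec]
    have h1 := hTp j
    rcases Nat.eq_zero_or_pos j with rfl | hj
    · linarith
    · have h2 := hTp (j - 1)
      rw [Nat.sub_add_cancel hj] at h2
      linarith
  obtain ⟨j, rfl⟩ := Nat.exists_eq_add_of_le' hm
  obtain ⟨j', rfl⟩ := Nat.exists_eq_add_of_le' hm'
  rw [hs.injective h]

theorem exists_ncard_fibonacci_sub_tribonacci_le {F T : ℕ → ℤ} (hF0 : F 0 = 0) (hF1 : F 1 = 1)
    (hFrec : ∀ n : ℕ, F (n + 2) = F n + F (n + 1))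
    (hT0 : T 0 = 0) (hT1 : T 1 = 1) (hT2 : T 2 = 1)
    (hTrec : ∀ m : ℕ, T (m + 3) = T m + T (m + 1) + T (m + 2)) {φ τ : ℝ} (hφ1 : 1 < φ)
    (hφ : φ ^ 2 = φ + 1) (hτ1 : 1 < τ) (hτ : τ ^ 3 = τ ^ 2 + τ + 1) :
    ∃ c : ℝ, ∀ x : ℝ, 1 ≤ x →
      {z : ℤ | |(z : ℝ)| ≤ x ∧ ∃ n m : ℕ, z = F n - T m}.Finite ∧
      ({z : ℤ | |(z : ℝ)| ≤ x ∧ ∃ n m : ℕ, z = F n - T m}.ncard : ℝ) ≤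
        Real.log x ^ 2 / (Real.log φ * Real.log τ) + c * (Real.log x + 1) := by
  have hFp := fibonacci_pos hF0 hF1 hFrec
  have hTp := tribonacci_pos hT0 hT1 hT2 hTrec
  have hτ2 : τ < 2 := by
    by_contra! h
    nlinarith
  have hφ2 : φ < 2 := by
    by_contra! h
    nlinarith
  have ha : 0 < Real.log φ := Real.log_pos hφ1
  have hb : 0 < Real.log τ := Real.log_pos hτ1
  have hg : 0 < Real.log (5 / 4) := Real.log_pos (by norm_num)
  have h8 : 0 < Real.log 8 := Real.log_pos (by norm_num)
  obtain ⟨n₀, hn₀⟩ := (finite_setOf_fibonacci_close_tribonacci hF0 hF1 hFrec hT0 hT1 hT2 hTrec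
    hφ1 hφ hτ1 hτ).bddAbove
  obtain ⟨k, hk⟩ := exists_nat_ge (Real.log 12 / Real.log τ + 1)
  set a := Real.log φ with ha'
  set b := Real.log τ with hb'
  set α := Real.log 8 / a + 1 with hα
  set β := Real.log 8 / b + 1 with hβ
  refine ⟨α / b + β / a + α * β + (1 / Real.log (5 / 4) + (n₀ + 1)) * (2 * k + 1), fun x hx => ?_⟩
  have hL : 0 ≤ Real.log x := Real.log_nonneg hx
  set L := Real.log x with hL'
  set P := ⌊(L + Real.log 8) / a⌋₊ with hP
  set Q := ⌊(L + Real.log 8) / b⌋₊ with hQ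
  set R := n₀ + ⌊L / Real.log (5 / 4)⌋₊ with hR
  set U : Finset ℤ := (Finset.range (P + 1) ×ˢ Finset.range (Q + 1)).image
      (fun p => F p.1 - T p.2) ∪ (Finset.range (R + 1) ×ˢ Finset.range (2 * k + 1)).image
      (fun p => F p.1 - T (⌊p.1 * a / b⌋₊ + p.2 - k)) with hU
  have hsub : {z : ℤ | |(z : ℝ)| ≤ x ∧ ∃ n m : ℕ, z = F n - T m} ⊆ U := by
    rintro z ⟨hz, n, m, rfl⟩
    push_cast at hz
    have hz' := abs_le.1 hz
    have hFn0 : (0 : ℝ) ≤ F n := by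
      cases n with
      | zero => simp [hF0]
      | succ n => exact_mod_cast (hFp n).le
    have hTm0 : (0 : ℝ) ≤ T m := by
      cases m with
      | zero => simp [hT0]
      | succ m => exact_mod_cast (hTp m).le
    rw [hU, Finset.coe_union]
    by_cases hc : (F n : ℝ) ≤ 2 * x ∧ (T m : ℝ) ≤ 2 * x
    · left
      have hn : n ≤ P := by
        rcases Nat.eq_zero_or_pos n with rfl | hn
        · exact Nat.zero_le _
        obtain ⟨i, rfl⟩ := Nat.exists_eq_succ_of_ne_zero hn.ne'
        have h1 := golden_pow_le hF0 hF1 hFrec hφ1 hφ i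
        have h2 : φ ^ (i + 1) ≤ x * 8 := by
          have : φ ^ 2 * (F (i + 1) : ℝ) ≤ 4 * F (i + 1) := by
            have : φ ^ 2 ≤ 4 := by nlinarith
            gcongr
          linarith [hc.1]
        have h3 := Real.log_le_log (by positivity) h2
        rw [Real.log_pow, Real.log_mul (by positivity) (by norm_num)] at h3
        exact Nat.le_floor ((le_div_iff₀ ha).2 h3)
      have hm : m ≤ Q := by
        rcases Nat.eq_zero_or_pos m with rfl | hm
        · exact Nat.zero_le _
        obtain ⟨i, rfl⟩ := Nat.exists_eq_succ_of_ne_zero hm.ne'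
        have h1 := tribonacci_pow_le hT0 hT1 hT2 hTrec hτ1 hτ i
        have h2 : τ ^ (i + 1) ≤ x * 8 := by
          have : τ ^ 2 * (T (i + 1) : ℝ) ≤ 4 * T (i + 1) := by
            have : τ ^ 2 ≤ 4 := by nlinarith
            gcongr
          linarith [hc.2]
        have h3 := Real.log_le_log (by positivity) h2
        rw [Real.log_pow, Real.log_mul (by positivity) (by norm_num)] at h3
        exact Nat.le_floor ((le_div_iff₀ hb).2 h3)
      rw [Finset.coe_image]
      exact ⟨(n, m), by simp; omega, rfl⟩
    · right
      have hFT : (F n : ℝ) ≤ 3 * T m ∧ (T m : ℝ) ≤ 3 * F n ∧ (0 : ℝ) < F n ∧ (0 : ℝ) < T m := by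
        rw [not_and_or, not_le, not_le] at hc
        rcases hc with hc | hc <;> refine ⟨?_, ?_, ?_, ?_⟩ <;> linarith
      obtain ⟨h1, h2, h3, h4⟩ := hFT
      have hn0 : n ≠ 0 := by rintro rfl; simp [hF0] at h3
      have hm0 : m ≠ 0 := by rintro rfl; simp [hT0] at h4
      have hstrip := abs_log_mul_sub_le hF0 hF1 hFrec hT0 hT1 hT2 hTrec hφ1 hφ hτ1 hτ hn0 hm0
        (by exact_mod_cast h1) (by exact_mod_cast h2)
      obtain ⟨j, hj, hjm⟩ := exists_floor_add_sub_eq hb ha.le hk hstrip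
      have hn : n ≤ R := by
        by_cases hcl : |(F n : ℝ) - T m| ≤ (5 / 4) ^ n
        · exact (hn₀ ⟨m, hcl⟩).trans (Nat.le_add_right _ _)
        · rw [not_le] at hcl
          have h5 := Real.log_le_log (by positivity) (hcl.le.trans hz)
          rw [Real.log_pow] at h5
          exact (Nat.le_floor ((le_div_iff₀ hg).2 h5)).trans (Nat.le_add_left _ _)
      rw [Finset.coe_image]
      refine ⟨(n, j), ?_, ?_⟩
      · rw [Finset.mem_range] at hj
        simp; omega
      · simp only
        rw [hjm]
  refine ⟨U.finite_toSet.subset hsub, ?_⟩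
  have hcard : ({z : ℤ | |(z : ℝ)| ≤ x ∧ ∃ n m : ℕ, z = F n - T m}.ncard : ℝ) ≤
      (P + 1) * (Q + 1) + (R + 1) * (2 * k + 1) := by
    have h1 := Set.ncard_le_ncard hsub U.finite_toSet
    rw [Set.ncard_coe_finset] at h1
    have h2 : U.card ≤ (P + 1) * (Q + 1) + (R + 1) * (2 * k + 1) := by
      refine (Finset.card_union_le _ _).trans (add_le_add ?_ ?_) <;>
        exact Finset.card_image_le.trans (by simp)
    exact_mod_cast h1.trans h2
  refine hcard.trans ?_
  have hPle : (P : ℝ) + 1 ≤ L / a + α := by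
    have : (P : ℝ) ≤ (L + Real.log 8) / a := Nat.floor_le (by positivity)
    rw [add_div] at this
    rw [hα]; linarith
  have hQle : (Q : ℝ) + 1 ≤ L / b + β := by
    have : (Q : ℝ) ≤ (L + Real.log 8) / b := Nat.floor_le (by positivity)
    rw [add_div] at this
    rw [hβ]; linarith
  have hRle : (R : ℝ) + 1 ≤ (1 / Real.log (5 / 4) + (n₀ + 1)) * (L + 1) := by
    have h1 : (⌊L / Real.log (5 / 4)⌋₊ : ℝ) ≤ L / Real.log (5 / 4) := Nat.floor_le (by positivity)
    have h2 : (1 / Real.log (5 / 4) + (n₀ + 1)) * (L + 1) = L / Real.log (5 / 4) + n₀ + 1 +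
      (1 / Real.log (5 / 4) + (n₀ + 1) * L) := by ring
    have h3 : 0 ≤ 1 / Real.log (5 / 4) + (n₀ + 1) * L := by positivity
    rw [h2, hR]
    push_cast
    linarith
  have hα0 : 0 < α := by positivity
  have hβ0 : 0 < β := by positivity
  calc _ ≤ (L / a + α) * (L / b + β) +
        (1 / Real.log (5 / 4) + (n₀ + 1)) * (L + 1) * (2 * k + 1) := by gcongr
    _ = L ^ 2 / (a * b) + (α / b + β / a + α * β + (1 / Real.log (5 / 4) + (n₀ + 1)) *
          (2 * k + 1)) * (L + 1) - (α / b + β / a + α * β * L) := by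
        field_simp
        ring
    _ ≤ _ := by
        have : 0 ≤ α / b + β / a + α * β * L := by positivity
        linarith

theorem exists_le_ncard_fibonacci_sub_tribonacci {F T : ℕ → ℤ} (hF0 : F 0 = 0) (hF1 : F 1 = 1)
    (hFrec : ∀ n : ℕ, F (n + 2) = F n + F (n + 1))
    (hT0 : T 0 = 0) (hT1 : T 1 = 1) (hT2 : T 2 = 1)
    (hTrec : ∀ m : ℕ, T (m + 3) = T m + T (m + 1) + T (m + 2)) {φ τ : ℝ} (hφ1 : 1 < φ)
    (hφ : φ ^ 2 = φ + 1) (hτ1 : 1 < τ) (hτ : τ ^ 3 = τ ^ 2 + τ + 1) :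
    ∃ c : ℝ, ∀ x : ℝ, 1 ≤ x → 2 * Real.log φ ≤ Real.log x → 2 * Real.log τ ≤ Real.log x →
      {z : ℤ | |(z : ℝ)| ≤ x ∧ ∃ n m : ℕ, z = F n - T m}.Finite →
      Real.log x ^ 2 / (Real.log φ * Real.log τ) - c * (Real.log x + 1) ≤
      {z : ℤ | |(z : ℝ)| ≤ x ∧ ∃ n m : ℕ, z = F n - T m}.ncard := by
  have hFp := fibonacci_pos hF0 hF1 hFrec
  have hTp := tribonacci_pos hT0 hT1 hT2 hTrec
  have ha : 0 < Real.log φ := Real.log_pos hφ1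
  have hb : 0 < Real.log τ := Real.log_pos hτ1
  obtain ⟨k, hk⟩ := exists_nat_ge (Real.log 12 / Real.log τ + 1)
  have hstrip : ∀ {n m : ℕ}, n ≠ 0 → m ≠ 0 → F n ≤ 3 * T m → T m ≤ 3 * F n → _ := fun hn hm =>
    abs_log_mul_sub_le hF0 hF1 hFrec hT0 hT1 hT2 hTrec hφ1 hφ hτ1 hτ hn hm
  set a := Real.log φ with ha'
  set b := Real.log τ with hb'
  refine ⟨2 / a + 2 / b + (1 / a + 1) * (2 * k + 1), fun x hx hLa hLb hfin => ?_⟩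
  have hL : 0 ≤ Real.log x := Real.log_nonneg hx
  set L := Real.log x with hL'
  set P := ⌊L / a⌋₊ with hP
  set Q := ⌊L / b⌋₊ with hQ
  set B : Finset (ℕ × ℕ) := Finset.Icc 2 P ×ˢ Finset.Icc 2 Q with hB
  classical
  set V := B.filter fun p => ¬ |(p.2 : ℝ) * b - p.1 * a| ≤ Real.log 12 with hV
  have hinj : Set.InjOn (fun p : ℕ × ℕ => F p.1 - T p.2) V := by
    have key : ∀ n m n' m' : ℕ, (n, m) ∈ V → (n', m') ∈ V → F n - T m = F n' - T m' →
        ¬ n' < n := by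
      intro n m n' m' h h' he hlt
      simp only [hV, hB, Finset.mem_filter, Finset.mem_product, Finset.mem_Icc] at h h'
      obtain ⟨h1, h2⟩ := le_three_mul_of_sub_eq_sub hF0 hF1 hFrec hT0 hT1 hT2 hTrec
        h'.1.1.1 h.1.2.1 h'.1.2.1 hlt he
      exact h.2 (hstrip (by omega) (by omega) h1 h2)
    rintro ⟨n, m⟩ h ⟨n', m'⟩ h' he
    have h1 := key _ _ _ _ h h' he
    have h2 := key _ _ _ _ h' h he.symm
    obtain rfl : n = n' := by omega
    simp only [Finset.coe_filter, hV, hB, Finset.mem_product, Finset.mem_Icc, Set.mem_ofPred_eq]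
      at h h'
    have he' : T m = T m' := by simpa using he
    rw [eq_of_tribonacci_eq hT0 hT1 hT2 hTrec h.1.2.1 h'.1.2.1 he']
  have hsub : ((V.image fun p : ℕ × ℕ => F p.1 - T p.2 : Finset ℤ) : Set ℤ) ⊆
      {z : ℤ | |(z : ℝ)| ≤ x ∧ ∃ n m : ℕ, z = F n - T m} := by
    intro z hz
    rw [Finset.coe_image] at hz
    obtain ⟨⟨n, m⟩, hp, rfl⟩ := hz
    refine ⟨?_, n, m, rfl⟩
    simp only [Finset.coe_filter, hV, hB, Finset.mem_product, Finset.mem_Icc, Set.mem_ofPred_eq]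
      at hp
    obtain ⟨⟨⟨hn2, hnP⟩, hm2, hmQ⟩, -⟩ := hp
    have hFx : (F n : ℝ) ≤ x := by
      have h1 := mul_le_golden_pow hF0 hF1 hFrec hφ n
      have h2 : (0 : ℝ) < F n := by
        obtain ⟨i, rfl⟩ := Nat.exists_eq_succ_of_ne_zero (show n ≠ 0 by omega)
        exact_mod_cast hFp i
      have h3 : φ ^ n ≤ x := by
        rw [← Real.log_le_log_iff (by positivity) (by linarith), Real.log_pow]
        exact (le_div_iff₀ ha).1 ((Nat.cast_le.2 hnP).trans (Nat.floor_le (by positivity)))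
      nlinarith
    have hTx : (T m : ℝ) ≤ x := by
      have h1 := mul_le_tribonacci_pow hT0 hT1 hT2 hTrec hτ1 hτ m
      have h2 : (0 : ℝ) < T m := by
        obtain ⟨i, rfl⟩ := Nat.exists_eq_succ_of_ne_zero (show m ≠ 0 by omega)
        exact_mod_cast hTp i
      have h3 : τ ^ m ≤ x := by
        rw [← Real.log_le_log_iff (by positivity) (by linarith), Real.log_pow]
        exact (le_div_iff₀ hb).1 ((Nat.cast_le.2 hmQ).trans (Nat.floor_le (by positivity)))
      nlinarith
    have hF0' : (0 : ℝ) ≤ F n := by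
      obtain ⟨i, rfl⟩ := Nat.exists_eq_succ_of_ne_zero (show n ≠ 0 by omega)
      exact_mod_cast (hFp i).le
    have hT0' : (0 : ℝ) ≤ T m := by
      obtain ⟨i, rfl⟩ := Nat.exists_eq_succ_of_ne_zero (show m ≠ 0 by omega)
      exact_mod_cast (hTp i).le
    push_cast
    rw [abs_le]
    constructor <;> linarith
  have hVN : V.card ≤ {z : ℤ | |(z : ℝ)| ≤ x ∧ ∃ n m : ℕ, z = F n - T m}.ncard := by
    have h1 := Set.ncard_le_ncard hsub hfin
    rwa [Set.ncard_coe_finset, Finset.card_image_of_injOn hinj] at h1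
  have hBV : B.card ≤ V.card + (P + 1) * (2 * k + 1) := by
    rw [← Finset.card_filter_add_card_filter_not (s := B)
      (fun p => |(p.2 : ℝ) * b - p.1 * a| ≤ Real.log 12), add_comm]
    refine Nat.add_le_add_left ?_ _
    have h1 : (B.filter fun p => |(p.2 : ℝ) * b - p.1 * a| ≤ Real.log 12) ⊆
        (Finset.range (P + 1) ×ˢ Finset.range (2 * k + 1)).image
          (fun p => (p.1, ⌊p.1 * a / b⌋₊ + p.2 - k)) := by
      rintro ⟨n, m⟩ h
      simp only [hB, Finset.mem_filter, Finset.mem_product, Finset.mem_Icc] at h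
      obtain ⟨j, hj, hjm⟩ := exists_floor_add_sub_eq hb ha.le hk h.2
      rw [Finset.mem_image]
      refine ⟨(n, j), ?_, ?_⟩
      · rw [Finset.mem_product]
        exact ⟨Finset.mem_range.2 (by simp only; omega), hj⟩
      · simp only
        rw [hjm]
    exact (Finset.card_le_card h1).trans (Finset.card_image_le.trans (by simp))
  have hBc : (L / a - 2) * (L / b - 2) ≤ B.card := by
    have h1 : L / a - 2 ≤ (P + 1 - 2 : ℕ) := by
      have h2 : L / a < P + 1 := Nat.lt_floor_add_one _
      have h3 : (P : ℝ) ≤ (P + 1 - 2 : ℕ) + 1 := by exact_mod_cast (show P ≤ P + 1 - 2 + 1 by omega)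
      linarith
    have h2 : L / b - 2 ≤ (Q + 1 - 2 : ℕ) := by
      have h2 : L / b < Q + 1 := Nat.lt_floor_add_one _
      have h3 : (Q : ℝ) ≤ (Q + 1 - 2 : ℕ) + 1 := by exact_mod_cast (show Q ≤ Q + 1 - 2 + 1 by omega)
      linarith
    have h4 : 0 ≤ L / b - 2 := by rw [sub_nonneg, le_div_iff₀ hb]; exact hLb
    rw [hB, Finset.card_product, Nat.card_Icc, Nat.card_Icc, Nat.cast_mul]
    exact mul_le_mul h1 h2 h4 (Nat.cast_nonneg _)
  have hPle : (P : ℝ) ≤ L / a := Nat.floor_le (by positivity)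
  have h1 : (B.card : ℝ) ≤ V.card + (P + 1) * (2 * k + 1) := by exact_mod_cast hBV
  have h2 : (V.card : ℝ) ≤ {z : ℤ | |(z : ℝ)| ≤ x ∧ ∃ n m : ℕ, z = F n - T m}.ncard := by
    exact_mod_cast hVN
  have h3 : ((P : ℝ) + 1) * (2 * k + 1) ≤ (L / a + 1) * (2 * k + 1) := by gcongr
  have h4 : (L / a - 2) * (L / b - 2) - (L / a + 1) * (2 * k + 1) = L ^ 2 / (a * b) -
      (2 / a + 2 / b + (1 / a + 1) * (2 * k + 1)) * (L + 1) +
      (4 + 2 / a + 2 / b + (1 / a + L) * (2 * k + 1)) := by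
    field_simp
    ring
  have h5 : 0 ≤ 4 + 2 / a + 2 / b + (1 / a + L) * (2 * k + 1) := by positivity
  linarith

end Counting

section Main

lemma tribonacci_constant_spec :
    1 < (1 + (19 + 3 * Real.sqrt 33) ^ ((1 : ℝ) / 3) +
      (19 - 3 * Real.sqrt 33) ^ ((1 : ℝ) / 3)) / 3 ∧
    ((1 + (19 + 3 * Real.sqrt 33) ^ ((1 : ℝ) / 3) +
      (19 - 3 * Real.sqrt 33) ^ ((1 : ℝ) / 3)) / 3) ^ 3 =
    ((1 + (19 + 3 * Real.sqrt 33) ^ ((1 : ℝ) / 3) +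
      (19 - 3 * Real.sqrt 33) ^ ((1 : ℝ) / 3)) / 3) ^ 2 +
    (1 + (19 + 3 * Real.sqrt 33) ^ ((1 : ℝ) / 3) +
      (19 - 3 * Real.sqrt 33) ^ ((1 : ℝ) / 3)) / 3 + 1 := by
  have hs0 : 0 ≤ Real.sqrt 33 := Real.sqrt_nonneg _
  have hs2 : Real.sqrt 33 ^ 2 = 33 := Real.sq_sqrt (by norm_num)
  have hp : 0 ≤ 19 + 3 * Real.sqrt 33 := by positivity
  have hm : 0 ≤ 19 - 3 * Real.sqrt 33 := by nlinarith
  have cube {y : ℝ} (hy : 0 ≤ y) : (y ^ ((1 : ℝ) / 3)) ^ 3 = y := by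
    rw [← Real.rpow_natCast, ← Real.rpow_mul hy]
    norm_num
  have hu3 := cube hp
  have hv3 := cube hm
  have hu0 := Real.rpow_nonneg hp ((1 : ℝ) / 3)
  have hv0 := Real.rpow_nonneg hm ((1 : ℝ) / 3)
  set u := (19 + 3 * Real.sqrt 33) ^ ((1 : ℝ) / 3)
  set v := (19 - 3 * Real.sqrt 33) ^ ((1 : ℝ) / 3)
  have huv : u * v = 4 := by
    refine (pow_left_inj₀ (mul_nonneg hu0 hv0) (by norm_num) three_ne_zero).mp ?_
    rw [mul_pow, hu3, hv3]
    linear_combination -9 * hs2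
  have hu2 : 2 < u := by
    refine lt_of_pow_lt_pow_left₀ 3 hu0 ?_
    rw [hu3]
    linarith
  constructor
  · have hv : 0 < v := by
      by_contra! h
      nlinarith
    linarith
  · linear_combination (hu3 + hv3) / 27 + (u + v) / 9 * huv

theorem fibonacci_minus_tribonacci_asymptotic
    (F T : ℕ → ℤ) (hF0 : F 0 = 0) (hF1 : F 1 = 1)
    (hFrec : ∀ n : ℕ, F (n + 2) = F n + F (n + 1))
    (hT0 : T 0 = 0) (hT1 : T 1 = 1) (hT2 : T 2 = 1)
    (hTrec : ∀ m : ℕ, T (m + 3) = T m + T (m + 1) + T (m + 2)) :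
    Tendsto (fun x : ℝ =>
      (Nat.card {c : ℤ | (|c| : ℝ) ≤ x ∧ ∃ n m : ℕ, c = F n - T m} : ℝ) /
        ((Real.log x) ^ 2 /
          (Real.log ((1 + Real.sqrt 5) / 2) *
            Real.log ((1 + (19 + 3 * Real.sqrt 33) ^ ((1 : ℝ) / 3) +
              (19 - 3 * Real.sqrt 33) ^ ((1 : ℝ) / 3)) / 3))))
      atTop (nhds 1) := by
  obtain ⟨hτ1, hτ⟩ := tribonacci_constant_spec
  set τ := (1 + (19 + 3 * Real.sqrt 33) ^ ((1 : ℝ) / 3) +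
    (19 - 3 * Real.sqrt 33) ^ ((1 : ℝ) / 3)) / 3
  have hφ1 : 1 < (1 + Real.sqrt 5) / 2 := Real.one_lt_goldenRatio
  have hφ : ((1 + Real.sqrt 5) / 2) ^ 2 = (1 + Real.sqrt 5) / 2 + 1 := Real.goldenRatio_sq
  set φ := (1 + Real.sqrt 5) / 2
  obtain ⟨c, hc⟩ := exists_ncard_fibonacci_sub_tribonacci_le hF0 hF1 hFrec hT0 hT1 hT2 hTrec
    hφ1 hφ hτ1 hτ
  obtain ⟨d, hd⟩ := exists_le_ncard_fibonacci_sub_tribonacci hF0 hF1 hFrec hT0 hT1 hT2 hTrec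
    hφ1 hφ hτ1 hτ
  have ha : 0 < Real.log φ := Real.log_pos hφ1
  have hb : 0 < Real.log τ := Real.log_pos hτ1
  have hlim (e : ℝ) : Tendsto (fun x : ℝ => 1 + e * (Real.log φ * Real.log τ) *
      ((Real.log x)⁻¹ + (Real.log x)⁻¹ ^ 2)) atTop (nhds 1) := by
    have h := Real.tendsto_log_atTop.inv_tendsto_atTop
    simpa using ((h.add (h.pow 2)).const_mul (e * (Real.log φ * Real.log τ))).const_add 1
  refine tendsto_of_tendsto_of_tendsto_of_le_of_le' (hlim (-d)) (hlim c) ?_ ?_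
  · filter_upwards [eventually_ge_atTop 1,
      Real.tendsto_log_atTop.eventually_ge_atTop (2 * Real.log φ),
      Real.tendsto_log_atTop.eventually_ge_atTop (2 * Real.log τ),
      Real.tendsto_log_atTop.eventually_gt_atTop 0] with x hx h1 h2 hL
    rw [Nat.card_coe_set_eq, le_div_iff₀ (by positivity)]
    refine le_trans (le_of_eq ?_) (hd x hx h1 h2 (hc x hx).1)
    field_simp
    ring
  · filter_upwards [eventually_ge_atTop 1,
      Real.tendsto_log_atTop.eventually_gt_atTop 0] with x hx hL
    rw [Nat.card_coe_set_eq, div_le_iff₀ (by positivity)]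
    refine (hc x hx).2.trans (le_of_eq ?_)
    field_simp

end Main
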